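/- For every ε > 0 and every integer k ≥ 2 there exists C such that for all integers p, q and n with n positive and coprime to both p and q, |q| > C, |p| > |q|^C and n > |p|^C, there exists a permutation f of ℤ/nℤ with f^k = id and f(q·x + 1) = p·f(x) for at least (1−ε)n elements x ∈ ℤ/nℤ. -/

import Mathlib

theorem mb_ediv_unique {b x y k l : ℤ} (hx0 : 0 ≤ x) (hx : x < b) (hy0 : 0 ≤ y) (hy : y < b)
    (h : x + b * k = y + b * l) : x = y ∧ k = l := by
  have hb : 0 < b := lt_of_le_of_lt hx0 hx
  have h1 : x = y := by
    have := congrArg (· % b) h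
    simpa [Int.add_mul_emod_self_left, Int.emod_eq_of_lt hx0 hx, Int.emod_eq_of_lt hy0 hy] using this
  refine ⟨h1, ?_⟩
  subst h1
  have : b * k = b * l := by linarith
  exact mul_left_cancel₀ hb.ne' this

theorem mb_tile {ι : Type*} [DecidableEq ι] (s : ι → ℤ) (L : ℕ) (hL : 0 < L) (Λ : ℕ)
    (hΛ2 : 2 ≤ Λ) (hΛ : L ≤ Λ) (hs : ∀ a, s a ≠ 0)
    (hsep : ∀ a b, a ≠ b → Λ * |s a| ≤ |s b| ∨ Λ * |s b| ≤ |s a|) (S : Finset ι) :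
    ∀ N0 : ℤ, 0 ≤ N0 → (∀ a ∈ S, Λ * |s a| ≤ N0) → ∃ E : Finset ℤ,
      (∀ z ∈ E, ∀ c : ι → ℤ, (∀ a ∈ S, 0 ≤ c a ∧ c a < L) →
        0 ≤ z + ∑ a ∈ S, c a * s a ∧ z + ∑ a ∈ S, c a * s a < N0) ∧
      (∀ z ∈ E, ∀ z' ∈ E, ∀ c c' : ι → ℤ, (∀ a ∈ S, 0 ≤ c a ∧ c a < L) →
        (∀ a ∈ S, 0 ≤ c' a ∧ c' a < L) →
        z + ∑ a ∈ S, c a * s a = z' + ∑ a ∈ S, c' a * s a → z = z' ∧ ∀ a ∈ S, c a = c' a) ∧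
      (N0 : ℝ) * (1 - (L : ℝ) / Λ) ^ S.card ≤ (E.card : ℝ) * (L : ℝ) ^ S.card := by
  induction S using Finset.induction_on_max_value (fun a => |s a|) with
  | empty =>
    intro N0 hN0 _
    refine ⟨Finset.Ico 0 N0, ?_, ?_, ?_⟩
    · intro z hz c _
      simpa using hz
    · intro z _ z' _ c c' _ _ h
      simpa using h
    · simp only [Finset.card_empty, pow_zero, mul_one, Int.card_Ico, sub_zero]
      have : ((N0.toNat : ℤ) : ℝ) = N0 := by rw [Int.toNat_of_nonneg hN0]
      exact_mod_cast this.ge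
  | insert a S haS hmax ih =>
    intro N0 hN0 hN
    set A : ℤ := |s a| with hA
    have hA0 : 0 < A := abs_pos.mpr (hs a)
    have hS : ∀ b ∈ S, (Λ : ℤ) * |s b| ≤ A := by
      intro b hb
      have hba : b ≠ a := fun h => haS (h ▸ hb)
      rcases hsep b a hba with h | h
      · exact h
      · have h1 := hmax b hb
        have : (2 : ℤ) ≤ Λ := by exact_mod_cast hΛ2
        nlinarith
    obtain ⟨E1, hE1, hE2, hE3⟩ := ih A hA0.le hS
    have hLz : (0 : ℤ) < L := by exact_mod_cast hL
    obtain ⟨M, hM⟩ : ∃ M : ℕ, (M : ℤ) = N0 / (L * A) :=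
      ⟨(N0 / (L * A)).toNat, Int.toNat_of_nonneg (Int.ediv_nonneg hN0 (by positivity))⟩
    have hM1 : (L : ℤ) * A * M ≤ N0 := by rw [hM]; exact Int.mul_ediv_self_le (by positivity)
    have hM2 : N0 < (L : ℤ) * A * (M + 1) := by
      have h := Int.lt_mul_ediv_self_add (x := N0) (k := L * A) (by positivity)
      rw [← hM] at h
      linarith
    -- the sign trick
    obtain ⟨t0, tw, htw⟩ : ∃ (t0 : ℤ) (tw : ℤ → ℤ), ∀ c : ℤ,
        t0 + c * s a = A * tw c ∧ (0 ≤ c → c < L → 0 ≤ tw c ∧ tw c < L) ∧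
        (∀ c', tw c = tw c' → c = c') := by
      rcases le_or_gt 0 (s a) with h | h
      · refine ⟨0, fun c => c, fun c => ⟨?_, fun h1 h2 => ⟨h1, h2⟩, fun c' h => h⟩⟩
        rw [hA, abs_of_nonneg h]; ring
      · refine ⟨(L - 1) * A, fun c => L - 1 - c, fun c => ⟨?_, fun h1 h2 => ⟨by linarith, by linarith⟩, fun c' h => by linarith⟩⟩
        rw [hA, abs_of_neg h]; ring
    have key : ∀ y ∈ E1, ∀ y' ∈ E1, ∀ k k' : ℤ, ∀ c c' : ι → ℤ,
        (∀ b ∈ insert a S, 0 ≤ c b ∧ c b < L) → (∀ b ∈ insert a S, 0 ≤ c' b ∧ c' b < L) →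
        (y + t0 + L * A * k) + ∑ b ∈ insert a S, c b * s b =
          (y' + t0 + L * A * k') + ∑ b ∈ insert a S, c' b * s b →
        y = y' ∧ k = k' ∧ ∀ b ∈ insert a S, c b = c' b := by
      intro y hy y' hy' k k' c c' hc hc' h
      rw [Finset.sum_insert haS, Finset.sum_insert haS] at h
      have r1 := hE1 y hy c (fun b hb => hc b (Finset.mem_insert_of_mem hb))
      have r2 := hE1 y' hy' c' (fun b hb => hc' b (Finset.mem_insert_of_mem hb))
      obtain ⟨e1, f1, g1⟩ := htw (c a)
      obtain ⟨e2, f2, g2⟩ := htw (c' a)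
      have f1' := f1 (hc a (Finset.mem_insert_self _ _)).1 (hc a (Finset.mem_insert_self _ _)).2
      have f2' := f2 (hc' a (Finset.mem_insert_self _ _)).1 (hc' a (Finset.mem_insert_self _ _)).2
      obtain ⟨u1, u2⟩ := mb_ediv_unique (b := A) (k := tw (c a) + L * k) (l := tw (c' a) + L * k')
        r1.1 r1.2 r2.1 r2.2 (by linear_combination h - e1 + e2)
      obtain ⟨v1, v2⟩ := mb_ediv_unique f1'.1 f1'.2 f2'.1 f2'.2 u2
      obtain ⟨w1, w2⟩ := hE2 y hy y' hy' c c' (fun b hb => hc b (Finset.mem_insert_of_mem hb))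
        (fun b hb => hc' b (Finset.mem_insert_of_mem hb)) u1
      refine ⟨w1, v2, fun b hb => ?_⟩
      rcases Finset.mem_insert.mp hb with rfl | hb
      · exact g1 _ v1
      · exact w2 b hb
    let F : ℤ × ℕ → ℤ := fun yk => yk.1 + t0 + L * A * yk.2
    refine ⟨(E1 ×ˢ Finset.range M).image F, ?_, ?_, ?_⟩
    · intro z hz c hc
      obtain ⟨⟨y, k⟩, hyk, rfl⟩ := Finset.mem_image.mp hz
      obtain ⟨hy, hk⟩ := Finset.mem_product.mp hyk
      simp only [Finset.mem_range] at hk hy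
      rw [Finset.sum_insert haS]
      have r1 := hE1 y hy c (fun b hb => hc b (Finset.mem_insert_of_mem hb))
      obtain ⟨e1, f1, g1⟩ := htw (c a)
      have f1' := f1 (hc a (Finset.mem_insert_self _ _)).1 (hc a (Finset.mem_insert_self _ _)).2
      have hk' : (k : ℤ) + 1 ≤ M := by exact_mod_cast hk
      have : F (y, k) + (c a * s a + ∑ x ∈ S, c x * s x) =
          (y + ∑ x ∈ S, c x * s x) + A * (tw (c a) + L * k) := by
        simp only [F]; linear_combination e1
      rw [this]
      constructor
      · have : 0 ≤ A * (tw (c a) + L * k) := mul_nonneg hA0.le (by have := f1'.1; positivity)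
        linarith [r1.1]
      · have h1 : tw (c a) + L * k + 1 ≤ L * M := by nlinarith [f1'.2]
        have h2 : A * (tw (c a) + L * k + 1) ≤ A * (L * M) := mul_le_mul_of_nonneg_left h1 hA0.le
        nlinarith [r1.2]
    · intro z hz z' hz' c c' hc hc' h
      obtain ⟨⟨y, k⟩, hyk, rfl⟩ := Finset.mem_image.mp hz
      obtain ⟨⟨y', k'⟩, hyk', rfl⟩ := Finset.mem_image.mp hz'
      obtain ⟨a1, a2, a3⟩ := key y (Finset.mem_product.mp hyk).1 y' (Finset.mem_product.mp hyk').1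
        k k' c c' hc hc' h
      refine ⟨?_, a3⟩
      simp only [F, a1, a2]
    · rw [Finset.card_image_of_injOn, Finset.card_product, Finset.card_range,
        Finset.card_insert_of_notMem haS]
      · have hAr : (0 : ℝ) < A := by exact_mod_cast hA0
        have hLr : (0 : ℝ) < L := by exact_mod_cast hL
        have hΛr : (0 : ℝ) < Λ := by exact_mod_cast (by omega : 0 < Λ)
        have hM2r : (N0 : ℝ) < (L : ℝ) * A * (M + 1) := by exact_mod_cast hM2
        have hNa : (Λ : ℝ) * A ≤ N0 := by exact_mod_cast hN a (Finset.mem_insert_self _ _)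
        have hr0 : (0 : ℝ) ≤ 1 - (L : ℝ) / Λ := by
          rw [sub_nonneg, div_le_one hΛr]; exact_mod_cast hΛ
        have h1 : (N0 : ℝ) * (1 - (L : ℝ) / Λ) ≤ L * M * A := by
          have : (L : ℝ) * A ≤ N0 * (L / Λ) := by
            rw [mul_div_assoc', le_div_iff₀ hΛr]; nlinarith
          nlinarith
        calc (N0 : ℝ) * (1 - (L : ℝ) / Λ) ^ (S.card + 1)
            = (N0 * (1 - (L : ℝ) / Λ)) * (1 - (L : ℝ) / Λ) ^ S.card := by ring
          _ ≤ (L * M * A) * (1 - (L : ℝ) / Λ) ^ S.card := by gcongr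
          _ = (L * M) * (A * (1 - (L : ℝ) / Λ) ^ S.card) := by ring
          _ ≤ (L * M) * (E1.card * (L : ℝ) ^ S.card) := by gcongr
          _ = _ := by push_cast; ring
      · rintro ⟨y, k⟩ hyk ⟨y', k'⟩ hyk' h
        simp only [Finset.coe_product, Set.mem_prod, Finset.mem_coe] at hyk hyk'
        obtain ⟨a1, a2, a3⟩ := key y hyk.1 y' hyk'.1
          k k' 0 0 (fun _ _ => ⟨le_rfl, hLz⟩) (fun _ _ => ⟨le_rfl, hLz⟩) (by simpa [F] using h)
        simp only [Prod.mk.injEq]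
        exact ⟨a1, by exact_mod_cast a2⟩

/-- Points that reach `E` within `W` steps of `Q`. -/
def mbEW {X : Type*} (Q : Equiv.Perm X) (E : Set X) (W : ℕ) : Set X :=
  {x | ∃ j < W, (Q ^ j) x ∈ E}

/-- `i` is the first positive hitting time of `E`. -/
def mbFst {X : Type*} (T : Equiv.Perm X) (E : Set X) (x : X) (i : ℕ) : Prop :=
  1 ≤ i ∧ (T ^ i) x ∈ E ∧ ∀ i', 1 ≤ i' → i' < i → (T ^ i') x ∉ E

theorem mbFst_unique {X : Type*} {T : Equiv.Perm X} {E : Set X} {x : X} {i j : ℕ}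
    (h : mbFst T E x i) (h' : mbFst T E x j) : i = j := by
  rcases lt_trichotomy i j with hlt | heq | hlt
  · exact absurd h.2.1 (h'.2.2 i h.1 hlt)
  · exact heq
  · exact absurd h'.2.1 (h.2.2 j h'.1 hlt)

theorem mbFst_fwd {X : Type*} {T : Equiv.Perm X} {E : Set X} {x : X} {i b : ℕ}
    (h : mbFst T E x i) (hb : b < i) : mbFst T E ((T ^ b) x) (i - b) := by
  refine ⟨by omega, ?_, fun i' h1 h2 => ?_⟩
  · rw [← Equiv.Perm.mul_apply, ← pow_add, Nat.sub_add_cancel hb.le]; exact h.2.1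
  · rw [← Equiv.Perm.mul_apply, ← pow_add]; exact h.2.2 _ (by omega) (by omega)

theorem mbFst_back {X : Type*} {T : Equiv.Perm X} {E : Set X} {x : X} {i b : ℕ}
    (h : mbFst T E ((T ^ b) x) i) (hb : ∀ t, 1 ≤ t → t ≤ b → (T ^ t) x ∉ E) :
    mbFst T E x (i + b) := by
  refine ⟨by have := h.1; omega, ?_, fun i' h1 h2 => ?_⟩
  · rw [pow_add, Equiv.Perm.mul_apply]; exact h.2.1
  · by_cases hi : i' ≤ b
    · exact hb i' h1 hi
    · have := h.2.2 (i' - b) (by omega) (by omega)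
      rwa [← Equiv.Perm.mul_apply, ← pow_add, Nat.sub_add_cancel (by omega)] at this

theorem mbFst_exists {X : Type*} {T : Equiv.Perm X} {E : Set X} {x : X} {N : ℕ}
    (h : ∃ i, 1 ≤ i ∧ i ≤ N ∧ (T ^ i) x ∈ E) : ∃ i ≤ N, mbFst T E x i := by
  classical
  have h' : ∃ i, 1 ≤ i ∧ (T ^ i) x ∈ E := let ⟨i, a, _, c⟩ := h; ⟨i, a, c⟩
  obtain ⟨i, a, b, c⟩ := h
  refine ⟨Nat.find h', (Nat.find_le ⟨a, c⟩).trans b, (Nat.find_spec h').1, (Nat.find_spec h').2, ?_⟩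
  intro i' h1 h2 h3
  exact Nat.find_min h' h2 ⟨h1, h3⟩

/-- The base of the two dimensional tower. -/
def mbRok {X : Type*} (P Q : Equiv.Perm X) (E : Set X) (W N N0 m : ℕ) : Set X :=
  {x | (∃ i ≤ N, m ∣ i ∧ ∀ a < m, mbFst P (mbEW Q E W) ((Q ^ a) x) i) ∧
    ∃ j ≤ N0, m ∣ j ∧ mbFst Q E x j}

theorem mb_mod_aux {m i b i' b' : ℕ} (hi : m ∣ i) (hi' : m ∣ i') (hb : b < m) (hb' : b' < m)
    (h : i - b = i' - b') (h0 : b < i) (h0' : b' < i') : b = b' := by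
  obtain ⟨u, rfl⟩ := hi
  obtain ⟨v, rfl⟩ := hi'
  have h1 : b' + m * u = b + m * v := by omega
  have := congrArg (· % m) h1
  simp [Nat.mod_eq_of_lt hb, Nat.mod_eq_of_lt hb'] at this
  exact this.symm

theorem mbRok_disj {X : Type*} {P Q : Equiv.Perm X} {E : Set X} {W N N0 m : ℕ}
    {r r' : X} (hr : r ∈ mbRok P Q E W N N0 m) (hr' : r' ∈ mbRok P Q E W N N0 m)
    {a b a' b' : ℕ} (ha : a < m) (hb : b < m) (ha' : a' < m) (hb' : b' < m)
    (h : (P ^ b) ((Q ^ a) r) = (P ^ b') ((Q ^ a') r')) : r = r' ∧ a = a' ∧ b = b' := by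
  obtain ⟨⟨i, _, hmi, hi⟩, j, _, hmj, hj⟩ := hr
  obtain ⟨⟨i', _, hmi', hi'⟩, j', _, hmj', hj'⟩ := hr'
  have l1 := Nat.le_of_dvd (hi a ha).1 hmi
  have l2 := Nat.le_of_dvd (hi' a' ha').1 hmi'
  have l3 := Nat.le_of_dvd hj.1 hmj
  have l4 := Nat.le_of_dvd hj'.1 hmj'
  have f1 := mbFst_fwd (hi a ha) (b := b) (by omega)
  have f2 := mbFst_fwd (hi' a' ha') (b := b') (by omega)
  rw [h] at f1
  have hbb : b = b' := mb_mod_aux hmi hmi' hb hb' (mbFst_unique f1 f2) (by omega) (by omega)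
  subst hbb
  have h' := (P ^ b).injective h
  have g1 := mbFst_fwd hj (b := a) (by omega)
  have g2 := mbFst_fwd hj' (b := a') (by omega)
  rw [h'] at g1
  have haa : a = a' := mb_mod_aux hmj hmj' ha ha' (mbFst_unique g1 g2) (by omega) (by omega)
  subst haa
  exact ⟨(Q ^ a).injective h', rfl, rfl⟩

/-- The exceptional set. -/
def mbZ0 {X : Type*} (P Q : Equiv.Perm X) (E : Set X) (W N N1 N2 : ℕ) : Set X :=
  {y | y ∈ mbEW Q E W ∨ y ∈ E ∨
    (∃ i, 1 ≤ i ∧ i ≤ N ∧ ¬ ((P ^ i) (Q y) ∈ mbEW Q E W ↔ (P ^ i) y ∈ mbEW Q E W)) ∨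
    (∀ i, 1 ≤ i → i ≤ N1 → (P ^ i) y ∉ mbEW Q E W) ∨
    (∀ j, 1 ≤ j → j ≤ N2 → (Q ^ j) y ∉ E)}

theorem mb_exists_compl {m : ℕ} (hm : 0 < m) (i : ℕ) : ∃ b < m, m ∣ i + b := by
  refine ⟨(m - i % m) % m, Nat.mod_lt _ hm, ?_⟩
  rw [Nat.dvd_iff_mod_eq_zero, Nat.add_mod, Nat.mod_mod, ← Nat.add_mod]
  have h1 := Nat.mod_lt i hm
  have h2 := Nat.div_add_mod i m
  have : i + (m - i % m) = m * (i / m + 1) := by rw [mul_add]; omega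
  rw [this, Nat.mul_mod_right]

theorem mbRok_cover {X : Type*} {P Q : Equiv.Perm X} (hPQ : Commute P Q) {E : Set X}
    {W N1 N2 m : ℕ} (hm : 0 < m) {x : X}
    (hx : ∀ b ≤ m, ∀ c ≤ 2 * m, (Q ^ c) ((P ^ b) x) ∉ mbZ0 P Q E W (N1 + m) N1 N2) :
    ∃ a < m, ∃ b < m, (Q ^ (m - a)) ((P ^ (m - b)) x) ∈ mbRok P Q E W (N1 + m) (N2 + m) m := by
  have hQ : ∀ b c a, (Q ^ a) ((Q ^ c) ((P ^ b) x)) = (Q ^ (a + c)) ((P ^ b) x) := by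
    intro b c a
    rw [pow_add, Equiv.Perm.mul_apply]
  have hP : ∀ b c a, (P ^ a) ((Q ^ c) ((P ^ b) x)) = (Q ^ c) ((P ^ (a + b)) x) := by
    intro b c a
    simp only [← Equiv.Perm.mul_apply]
    rw [← mul_assoc, (hPQ.pow_pow a c).eq, mul_assoc, ← pow_add]
  have hz : ∀ b ≤ m, ∀ c ≤ 2 * m, (Q ^ c) ((P ^ b) x) ∉ mbEW Q E W ∧ (Q ^ c) ((P ^ b) x) ∉ E ∧
      (∀ i, 1 ≤ i → i ≤ N1 + m → ((P ^ i) (Q ((Q ^ c) ((P ^ b) x))) ∈ mbEW Q E W ↔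
        (P ^ i) ((Q ^ c) ((P ^ b) x)) ∈ mbEW Q E W)) ∧
      (∃ i, 1 ≤ i ∧ i ≤ N1 ∧ (P ^ i) ((Q ^ c) ((P ^ b) x)) ∈ mbEW Q E W) ∧
      (∃ j, 1 ≤ j ∧ j ≤ N2 ∧ (Q ^ j) ((Q ^ c) ((P ^ b) x)) ∈ E) := by
    intro b hb c hc
    have := hx b hb c hc
    simp only [mbZ0, Set.mem_ofPred_eq, not_or] at this
    push Not at this
    obtain ⟨h1, h2, h3, h4, h5⟩ := this
    refine ⟨h1, h2, fun i a1 a2 => ?_, h4, h5⟩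
    have := h3 i a1 a2
    tauto
  obtain ⟨i0, hi0, hf⟩ := mbFst_exists (hz m le_rfl m (by omega)).2.2.2.1
  obtain ⟨b, hb, hbm⟩ := mb_exists_compl hm i0
  have hfy : mbFst P (mbEW Q E W) ((Q ^ m) ((P ^ (m - b)) x)) (i0 + b) := by
    apply mbFst_back
    · rw [hP, Nat.add_sub_cancel' hb.le]; exact hf
    · intro t h1 h2
      rw [hP]
      exact (hz _ (by omega) m (by omega)).1
  obtain ⟨j0, hj0, hg⟩ := mbFst_exists (hz (m - b) (by omega) m (by omega)).2.2.2.2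
  obtain ⟨a, ha, ham⟩ := mb_exists_compl hm j0
  have hgz : mbFst Q E ((Q ^ (m - a)) ((P ^ (m - b)) x)) (j0 + a) := by
    apply mbFst_back
    · rw [hQ, Nat.add_sub_cancel' ha.le]; exact hg
    · intro t h1 h2
      rw [hQ]
      exact (hz _ (by omega) _ (by omega)).2.1
  have hinv : ∀ c ≤ 2 * m, (mbFst P (mbEW Q E W) ((Q ^ c) ((P ^ (m - b)) x)) (i0 + b) ↔
      mbFst P (mbEW Q E W) ((Q ^ 0) ((P ^ (m - b)) x)) (i0 + b)) := by
    intro c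
    induction c with
    | zero => intro _; exact Iff.rfl
    | succ c ih =>
      intro hc
      rw [← ih (by omega)]
      have h3 := (hz (m - b) (by omega) c (by omega)).2.2.1
      have e : (Q ^ (c + 1)) ((P ^ (m - b)) x) = Q ((Q ^ c) ((P ^ (m - b)) x)) := by
        rw [pow_succ']; rfl
      rw [e]
      unfold mbFst
      refine and_congr_right fun h1 => and_congr (h3 _ h1 (by omega)) ?_
      refine forall_congr' fun i' => forall_congr' fun h1' => forall_congr' fun h2' => ?_
      exact not_congr (h3 i' h1' (by omega))
  refine ⟨a, ha, b, hb, ⟨i0 + b, by omega, hbm, fun a' ha' => ?_⟩, j0 + a, by omega, ham, hgz⟩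
  rw [hQ, hinv _ (by omega), ← hinv m (by omega)]
  exact hfy

theorem mb_ncard_pre {X : Type*} [Finite X] (f : Equiv.Perm X) (S : Set X) :
    {x | f x ∈ S}.ncard = S.ncard := by
  have : f '' {x | f x ∈ S} = S := by
    ext y
    constructor
    · rintro ⟨x, hx, rfl⟩; exact hx
    · intro hy; exact ⟨f.symm y, by simpa using hy, by simp⟩
  conv_rhs => rw [← this]
  exact (Set.ncard_image_of_injective _ f.injective).symm

theorem mbRok_card {X : Type*} [Finite X] {P Q : Equiv.Perm X} (hPQ : Commute P Q) {E : Set X}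
    {W N1 N2 m : ℕ} (hm : 0 < m) :
    Nat.card X ≤ m * m * (mbRok P Q E W (N1 + m) (N2 + m) m).ncard +
      (m + 1) * (2 * m + 1) * (mbZ0 P Q E W (N1 + m) N1 N2).ncard := by
  set R := mbRok P Q E W (N1 + m) (N2 + m) m
  set Z := mbZ0 P Q E W (N1 + m) N1 N2
  have hsub : (Set.univ : Set X) ⊆
      (⋃ ab ∈ Finset.range m ×ˢ Finset.range m, {x | (Q ^ (m - ab.1) * P ^ (m - ab.2)) x ∈ R}) ∪
      (⋃ bc ∈ Finset.range (m + 1) ×ˢ Finset.range (2 * m + 1), {x | (Q ^ bc.2 * P ^ bc.1) x ∈ Z}) := by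
    intro x _
    by_cases hx : ∀ b ≤ m, ∀ c ≤ 2 * m, (Q ^ c) ((P ^ b) x) ∉ Z
    · left
      obtain ⟨a, ha, b, hb, h⟩ := mbRok_cover hPQ hm hx
      simp only [Set.mem_iUnion]
      exact ⟨(a, b), by simp [ha, hb], h⟩
    · right
      push Not at hx
      obtain ⟨b, hb, c, hc, h⟩ := hx
      simp only [Set.mem_iUnion]
      exact ⟨(b, c), by simp; omega, h⟩
  rw [← Set.ncard_univ]
  refine (Set.ncard_le_ncard hsub (Set.toFinite _)).trans ((Set.ncard_union_le _ _).trans ?_)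
  gcongr
  · refine (Finset.set_ncard_biUnion_le _ _).trans ?_
    simp only [mb_ncard_pre]
    simp
  · refine (Finset.set_ncard_biUnion_le _ _).trans ?_
    simp only [mb_ncard_pre]
    simp

/-- Size of the exceptional set. -/
theorem mbZ0_card {X : Type*} [Finite X] {P Q : Equiv.Perm X} (hPQ : Commute P Q) {E : Set X}
    {W N N1 N2 : ℕ} :
    (mbZ0 P Q E W N N1 N2).ncard ≤ (W + 1 + 2 * N) * E.ncard +
      {x | ∀ i, 1 ≤ i → i ≤ N1 → ∀ j < W, (Q ^ j) ((P ^ i) x) ∉ E}.ncard +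
      {x | ∀ j, 1 ≤ j → j ≤ N2 → (Q ^ j) x ∉ E}.ncard := by
  have hsub : mbZ0 P Q E W N N1 N2 ⊆
      ((⋃ j ∈ Finset.range W, {x | (Q ^ j) x ∈ E}) ∪ E ∪
        (⋃ i ∈ Finset.Icc 1 N, ({x | (P ^ i) x ∈ E} ∪ {x | (Q ^ W * P ^ i) x ∈ E}))) ∪
      {x | ∀ i, 1 ≤ i → i ≤ N1 → ∀ j < W, (Q ^ j) ((P ^ i) x) ∉ E} ∪
      {x | ∀ j, 1 ≤ j → j ≤ N2 → (Q ^ j) x ∉ E} := by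
    intro x hx
    rcases hx with h | h | h | h | h
    · left; left; left; left
      obtain ⟨j, hj, h⟩ := h
      simp only [Set.mem_iUnion]
      exact ⟨j, by simpa using hj, h⟩
    · left; left; left; right; exact h
    · left; left; right
      obtain ⟨i, h1, h2, h⟩ := h
      simp only [Set.mem_iUnion]
      refine ⟨i, by simp [h1, h2], ?_⟩
      have hc : (P ^ i) (Q x) = Q ((P ^ i) x) := by
        rw [← Equiv.Perm.mul_apply, (hPQ.pow_left i).eq, Equiv.Perm.mul_apply]
      rw [hc] at h
      by_contra hcon
      simp only [Set.mem_union, Set.mem_ofPred_eq, not_or, Equiv.Perm.mul_apply] at hcon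
      obtain ⟨c1, c2⟩ := hcon
      apply h
      constructor
      · rintro ⟨j, hj, hh⟩
        rw [← Equiv.Perm.mul_apply, ← pow_succ] at hh
        rcases Nat.lt_or_ge (j + 1) W with hlt | hge
        · exact ⟨j + 1, hlt, hh⟩
        · have : j + 1 = W := by omega
          rw [this] at hh; exact absurd hh c2
      · rintro ⟨j, hj, hh⟩
        cases j with
        | zero => exact absurd hh c1
        | succ j =>
          refine ⟨j, by omega, ?_⟩
          rw [← Equiv.Perm.mul_apply, ← pow_succ]; exact hh
    · left; right
      intro i h1 h2 j hj hE
      exact h i h1 h2 ⟨j, hj, hE⟩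
    · right; exact h
  refine (Set.ncard_le_ncard hsub (Set.toFinite _)).trans ((Set.ncard_union_le _ _).trans ?_)
  refine Nat.add_le_add_right ((Set.ncard_union_le _ _).trans ?_) _
  refine Nat.add_le_add_right ((Set.ncard_union_le _ _).trans ?_) _
  have h1 : (⋃ j ∈ Finset.range W, {x | (Q ^ j) x ∈ E}).ncard ≤ W * E.ncard := by
    refine (Finset.set_ncard_biUnion_le _ _).trans ?_
    simp only [mb_ncard_pre]
    simp
  have h2 : (⋃ i ∈ Finset.Icc 1 N, ({x | (P ^ i) x ∈ E} ∪ {x | (Q ^ W * P ^ i) x ∈ E})).ncard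
      ≤ N * (2 * E.ncard) := by
    refine (Finset.set_ncard_biUnion_le _ _).trans ?_
    refine (Finset.sum_le_card_nsmul _ _ (2 * E.ncard) fun i _ => ?_).trans (by simp)
    refine (Set.ncard_union_le _ _).trans ?_
    rw [mb_ncard_pre, mb_ncard_pre]; omega
  have h3 := Set.ncard_union_le (⋃ j ∈ Finset.range W, {x | (Q ^ j) x ∈ E}) E
  nlinarith

/-- The tower base only depends on `E` along finitely many iterates. -/
theorem mbRok_local {X : Type*} {P Q : Equiv.Perm X} (hPQ : Commute P Q) {E : Set X}
    {W N N0 m J : ℕ} (hJ1 : N < J) (hJ2 : W + m ≤ J) (hJ3 : N0 < J) {x y : X}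
    (h : ∀ i < J, ∀ j < J, ((Q ^ j) ((P ^ i) x) ∈ E ↔ (Q ^ j) ((P ^ i) y) ∈ E))
    (hx : x ∈ mbRok P Q E W N N0 m) : y ∈ mbRok P Q E W N N0 m := by
  have hEW : ∀ i ≤ N, ∀ a < m, ((P ^ i) ((Q ^ a) x) ∈ mbEW Q E W ↔
      (P ^ i) ((Q ^ a) y) ∈ mbEW Q E W) := by
    intro i hi a ha
    have hc : ∀ z : X, (P ^ i) ((Q ^ a) z) = (Q ^ a) ((P ^ i) z) := by
      intro z
      rw [← Equiv.Perm.mul_apply, (hPQ.pow_pow i a).eq, Equiv.Perm.mul_apply]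
    unfold mbEW
    refine exists_congr fun j => and_congr_right fun hj => ?_
    rw [hc, hc, ← Equiv.Perm.mul_apply, ← pow_add, ← Equiv.Perm.mul_apply (Q ^ j), ← pow_add]
    exact h i (by omega) (j + a) (by omega)
  obtain ⟨⟨i, hiN, hmi, hi⟩, j, hjN, hmj, hj⟩ := hx
  refine ⟨⟨i, hiN, hmi, fun a ha => ?_⟩, j, hjN, hmj, ?_⟩
  · obtain ⟨h1, h2, h3⟩ := hi a ha
    exact ⟨h1, (hEW i hiN a ha).1 h2, fun i' a1 a2 => fun h4 =>
      h3 i' a1 a2 ((hEW i' (by omega) a ha).2 h4)⟩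
  · obtain ⟨h1, h2, h3⟩ := hj
    have h0 : ∀ j < J, ((Q ^ j) x ∈ E ↔ (Q ^ j) y ∈ E) := fun j hj => by
      simpa using h 0 (by omega) j hj
    exact ⟨h1, (h0 j (by omega)).1 h2, fun j' a1 a2 h4 => h3 j' a1 a2 ((h0 j' (by omega)).2 h4)⟩

theorem mb_count_avoid {B : Type*} [Fintype B] [DecidableEq B] (s : ℕ) (S : Finset B) :
    (((Finset.univ : Finset (B → Fin (s + 1))).filter (fun w => ∀ b ∈ S, w b ≠ 0)).card : ℝ) =
      ((s : ℝ) + 1) ^ (Fintype.card B) * (1 - 1 / ((s : ℝ) + 1)) ^ S.card := by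
  have h1 : (Finset.univ : Finset (B → Fin (s + 1))).filter (fun w => ∀ b ∈ S, w b ≠ 0) =
      Fintype.piFinset (fun b => if b ∈ S then (Finset.univ : Finset (Fin (s + 1))).erase 0
        else Finset.univ) := by
    ext w
    simp only [Finset.mem_filter, Finset.mem_univ, true_and, Fintype.mem_piFinset]
    refine forall_congr' fun b => ?_
    by_cases hb : b ∈ S <;> simp [hb]
  rw [h1, Fintype.card_piFinset]
  have h2 : ∀ b, ((if b ∈ S then (Finset.univ : Finset (Fin (s + 1))).erase 0
        else Finset.univ).card : ℝ) = ((s : ℝ) + 1) * (if b ∈ S then (1 - 1 / ((s : ℝ) + 1)) else 1) := by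
    intro b
    have : ((s : ℝ) + 1) ≠ 0 := by positivity
    by_cases hb : b ∈ S
    · simp [hb]; field_simp; ring
    · simp [hb]
  push_cast
  rw [Finset.prod_congr rfl (fun b _ => h2 b), Finset.prod_mul_distrib, Finset.prod_const,
    Finset.prod_ite, Finset.prod_const, Finset.prod_const_one, mul_one]
  simp [Finset.card_univ]

theorem mb_bern (s K : ℕ) : (1 - 1 / ((s : ℝ) + 1)) ^ K ≤ ((s : ℝ) + 1) / (s + 1 + K) := by
  have h1 : (0 : ℝ) < (s : ℝ) + 1 := by positivity
  rcases Nat.eq_zero_or_pos s with rfl | hs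
  · rcases Nat.eq_zero_or_pos K with rfl | hK
    · simp
    · simp [zero_pow hK.ne']; positivity
  have hs' : (0 : ℝ) < s := by exact_mod_cast hs
  have h2 := one_add_mul_le_pow (a := 1 / (s : ℝ)) (by have : (0:ℝ) ≤ 1 / s := by positivity
                                                       linarith) K
  have h3 : (1 - 1 / ((s : ℝ) + 1)) = (1 + 1 / (s : ℝ))⁻¹ := by field_simp; ring
  have h4 : (s + 1 + K : ℝ) / (s + 1) ≤ 1 + K * (1 / (s : ℝ)) := by
    rw [div_le_iff₀ h1]
    field_simp
    nlinarith [(Nat.cast_nonneg K : (0:ℝ) ≤ K)]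
  rw [h3, inv_pow]
  calc ((1 + 1 / (s : ℝ)) ^ K)⁻¹ ≤ ((s + 1 + K : ℝ) / (s + 1))⁻¹ := by
        apply inv_anti₀ (by positivity) (h4.trans h2)
    _ = _ := by rw [inv_div]

theorem mb_random {X B : Type*} [Fintype X] [Fintype B] [DecidableEq X] [DecidableEq B] (blk : X → B)
    (s A K1 K2 : ℕ) (G : Finset X) (S1 S2 : X → Finset B)
    (h1 : ∀ x ∈ G, (S1 x).card = K1) (h2 : ∀ x ∈ G, (S2 x).card = K2) :
    ∃ E0 : Set B, (A : ℝ) * ({x | blk x ∈ E0}.ncard : ℝ) +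
      ({x | x ∈ G ∧ ∀ b ∈ S1 x, b ∉ E0}.ncard : ℝ) +
      ({x | x ∈ G ∧ ∀ b ∈ S2 x, b ∉ E0}.ncard : ℝ) ≤
      (Fintype.card X : ℝ) * (A / ((s : ℝ) + 1) + ((s : ℝ) + 1) / (s + 1 + K1) + ((s : ℝ) + 1) / (s + 1 + K2)) := by
  classical
  set T := ((s : ℝ) + 1) ^ (Fintype.card B) with hT
  have hT0 : 0 < T := by positivity
  have hcard : (Fintype.card (B → Fin (s + 1)) : ℝ) = T := by simp [hT]
  have hav : ∀ S : Finset B, (((Finset.univ : Finset (B → Fin (s + 1))).filter (fun w => ∀ b ∈ S, w b ≠ 0)).card : ℝ) = T * (1 - 1 / ((s : ℝ) + 1)) ^ S.card := fun S => mb_count_avoid s S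
  have hE : ∀ b : B, (((Finset.univ : Finset (B → Fin (s + 1))).filter (fun w => w b = 0)).card : ℝ) = T * (1 / ((s : ℝ) + 1)) := by
    intro b
    have h := hav {b}
    simp only [Finset.mem_singleton, forall_eq, Finset.card_singleton, pow_one] at h
    have h' := Finset.card_filter_add_card_filter_not (s := (Finset.univ : Finset (B → Fin (s + 1)))) (fun w => w b = 0)
    rw [Finset.card_univ] at h'
    have h'' := congrArg (Nat.cast (R := ℝ)) h'
    rw [hcard] at h''
    push_cast at h''
    simp only [ne_eq] at h
    linarith
  let F : (B → Fin (s + 1)) → ℝ := fun w => (A : ℝ) * (((Finset.univ : Finset X).filter (fun x => w (blk x) = 0)).card : ℝ) +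
    ((G.filter (fun x => ∀ b ∈ S1 x, w b ≠ 0)).card : ℝ) + ((G.filter (fun x => ∀ b ∈ S2 x, w b ≠ 0)).card : ℝ)
  have hswap : ∀ (H : Finset X) (r : X → (B → Fin (s + 1)) → Prop) [∀ x w, Decidable (r x w)],
      (∑ w, ((H.filter (fun x => r x w)).card : ℝ)) = ∑ x ∈ H, ((Finset.univ.filter (fun w => r x w)).card : ℝ) := by
    intro H r _
    have := Finset.sum_card_bipartiteAbove_eq_sum_card_bipartiteBelow (s := H) (t := (Finset.univ : Finset (B → Fin (s + 1)))) r
    simp only [Finset.bipartiteAbove, Finset.bipartiteBelow] at this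
    exact_mod_cast this.symm
  have hsum : ∑ w, F w ≤ ∑ w : B → Fin (s + 1), (Fintype.card X : ℝ) * (A / ((s : ℝ) + 1) + ((s : ℝ) + 1) / (s + 1 + K1) + ((s : ℝ) + 1) / (s + 1 + K2)) := by
    rw [Finset.sum_const, Finset.card_univ, nsmul_eq_mul, hcard]
    simp only [F]
    rw [Finset.sum_add_distrib, Finset.sum_add_distrib, ← Finset.mul_sum, hswap _ (fun x w => w (blk x) = 0), hswap _ (fun x w => ∀ b ∈ S1 x, w b ≠ 0),
      hswap _ (fun x w => ∀ b ∈ S2 x, w b ≠ 0)]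
    have hG : (G.card : ℝ) ≤ Fintype.card X := by exact_mod_cast Finset.card_le_univ G
    have e1 : ∑ x : X, (((Finset.univ : Finset (B → Fin (s + 1))).filter (fun w => w (blk x) = 0)).card : ℝ) = Fintype.card X * (T * (1 / ((s : ℝ) + 1))) := by
      rw [Finset.sum_congr rfl (fun x _ => hE (blk x)), Finset.sum_const, Finset.card_univ, nsmul_eq_mul]
    have e2 : ∀ (S : X → Finset B) (K : ℕ), (∀ x ∈ G, (S x).card = K) → ∑ x ∈ G, (((Finset.univ : Finset (B → Fin (s + 1))).filter (fun w => ∀ b ∈ S x, w b ≠ 0)).card : ℝ) ≤ Fintype.card X * (T * (((s : ℝ) + 1) / (s + 1 + K))) := by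
      intro S K hK
      calc _ ≤ ∑ x ∈ G, (T * (((s : ℝ) + 1) / (s + 1 + K))) := by
            apply Finset.sum_le_sum
            intro x hx
            rw [hav, hK x hx]
            exact mul_le_mul_of_nonneg_left (mb_bern s K) hT0.le
        _ = G.card * (T * (((s : ℝ) + 1) / (s + 1 + K))) := by rw [Finset.sum_const, nsmul_eq_mul]
        _ ≤ _ := mul_le_mul_of_nonneg_right hG (by positivity)
    have := e2 S1 K1 h1
    have := e2 S2 K2 h2
    rw [e1]
    have e3 : T * ((Fintype.card X : ℝ) * (A / ((s : ℝ) + 1) + ((s : ℝ) + 1) / (s + 1 + K1) + ((s : ℝ) + 1) / (s + 1 + K2))) = A * (Fintype.card X * (T * (1 / ((s : ℝ) + 1)))) + Fintype.card X * (T * (((s : ℝ) + 1) / (s + 1 + K1))) + Fintype.card X * (T * (((s : ℝ) + 1) / (s + 1 + K2))) := by ring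
    linarith
  obtain ⟨w, -, hw⟩ := Finset.exists_le_of_sum_le ⟨fun _ => 0, Finset.mem_univ _⟩ hsum
  refine ⟨{b | w b = 0}, ?_⟩
  have c1 : {x | blk x ∈ {b | w b = 0}} = ((Finset.univ.filter (fun x => w (blk x) = 0) : Finset X) : Set X) := by ext; simp
  have c2 : ∀ S : X → Finset B, {x | x ∈ G ∧ ∀ b ∈ S x, b ∉ {b | w b = 0}} = ((G.filter (fun x => ∀ b ∈ S x, w b ≠ 0) : Finset X) : Set X) := by intro S; ext; simp
  rw [c1, c2, c2, Set.ncard_coe_finset, Set.ncard_coe_finset, Set.ncard_coe_finset]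
  exact hw

theorem mb_coll_card (n : ℕ) [NeZero n] (l G : ℕ) (hl : 0 < l) (hln : l ≤ n) (a b : ℤ)
    (hab : a ≠ b) (hG : |a - b| ≤ G) :
    {x : ZMod n | ((a : ZMod n) * x).val / l = ((b : ZMod n) * x).val / l}.ncard ≤
      2 * l * (2 * G + 3) := by
  classical
  have hn : 0 < n := Nat.pos_of_neZero n
  let e : ZMod n → ℤ := fun x => (((a : ZMod n) * x).val : ℤ) - (((b : ZMod n) * x).val : ℤ)
  let φ : ZMod n → ℤ × ℤ := fun x => (e x, ((a - b) * (x.val : ℤ) - e x) / n)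
  have hdvd : ∀ x, (n : ℤ) ∣ (a - b) * (x.val : ℤ) - e x := by
    intro x
    rw [← ZMod.intCast_zmod_eq_zero_iff_dvd]
    simp only [e]
    push_cast
    simp only [ZMod.natCast_val, ZMod.cast_id', id]
    ring
  have hinj : Function.Injective φ := by
    intro x y hxy
    have h1 : e x = e y := congrArg Prod.fst hxy
    have h2 : ((a - b) * (x.val : ℤ) - e x) / n = ((a - b) * (y.val : ℤ) - e y) / n := congrArg Prod.snd hxy
    have h3 : (a - b) * (x.val : ℤ) - e x = (a - b) * (y.val : ℤ) - e y := by
      rw [← Int.ediv_mul_cancel (hdvd x), h2, Int.ediv_mul_cancel (hdvd y)]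
    have h4 : (a - b) * (x.val : ℤ) = (a - b) * (y.val : ℤ) := by linarith
    have h5 : (x.val : ℤ) = y.val := mul_left_cancel₀ (sub_ne_zero.mpr hab) h4
    exact ZMod.val_injective n (by exact_mod_cast h5)
  have hsub : φ '' {x : ZMod n | ((a : ZMod n) * x).val / l = ((b : ZMod n) * x).val / l} ⊆
      ((Finset.Ioo (-(l : ℤ)) l ×ˢ Finset.Icc (-((G : ℤ) + 1)) (G + 1) : Finset (ℤ × ℤ)) : Set (ℤ × ℤ)) := by
    rintro _ ⟨x, hx, rfl⟩
    have hx' : ((a : ZMod n) * x).val / l = ((b : ZMod n) * x).val / l := hx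
    have hl1 : |e x| < l := by
      have A1 := Nat.div_add_mod ((a : ZMod n) * x).val l
      have A2 := Nat.div_add_mod ((b : ZMod n) * x).val l
      have A3 := Nat.mod_lt ((a : ZMod n) * x).val hl
      have A4 := Nat.mod_lt ((b : ZMod n) * x).val hl
      rw [← hx'] at A2
      simp only [e]
      rw [abs_lt]
      constructor <;> omega
    rw [abs_lt] at hl1
    simp only [Finset.coe_product, Set.mem_prod, Finset.coe_Ioo, Finset.coe_Icc, Set.mem_Ioo, Set.mem_Icc, φ]
    refine ⟨hl1, ?_⟩
    obtain ⟨t, ht⟩ := hdvd x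
    rw [ht, Int.mul_ediv_cancel_left _ (by exact_mod_cast hn.ne')]
    have hv : (x.val : ℤ) < n := by exact_mod_cast ZMod.val_lt x
    have hv0 : (0:ℤ) ≤ x.val := by positivity
    have hv1 : |(a - b) * (x.val : ℤ)| ≤ G * n := by
      rw [abs_mul, abs_of_nonneg hv0]
      exact mul_le_mul hG hv.le hv0 (by positivity)
    rw [abs_le] at hv1
    have hln' : (l : ℤ) ≤ n := by exact_mod_cast hln
    have hn' : (0 : ℤ) < n := by exact_mod_cast hn
    constructor <;> nlinarith
  calc _ = (φ '' _).ncard := (Set.ncard_image_of_injective _ hinj).symm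
    _ ≤ _ := Set.ncard_le_ncard hsub (Finset.finite_toSet _)
    _ ≤ _ := by
      rw [Set.ncard_coe_finset, Finset.card_product, Int.card_Ioo, Int.card_Icc]
      apply Nat.mul_le_mul <;> omega

/-- interior points of blocks -/
def mbInt (n l Δ : ℕ) (y : ZMod n) : Prop :=
  Δ ≤ y.val % l ∧ y.val % l + Δ < l ∧ y.val + Δ < n

theorem mbInt_shift (n : ℕ) [NeZero n] (l Δ : ℕ) (y : ZMod n) (h : mbInt n l Δ y) (e : ℤ) (he : |e| ≤ Δ) :
    (y + (e : ZMod n)).val / l = y.val / l := by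
  obtain ⟨h1, h2, h3⟩ := h
  rw [abs_le] at he
  have A1 := Nat.div_add_mod y.val l
  have hmod := Nat.mod_le y.val l
  have hnn : 0 ≤ (y.val : ℤ) + e := by omega
  obtain ⟨v, hv⟩ := Int.eq_ofNat_of_zero_le hnn
  have hvn : v < n := by omega
  have hcast : y + (e : ZMod n) = (v : ZMod n) := by
    have : (((y.val : ℤ) + e : ℤ) : ZMod n) = ((v : ℤ) : ZMod n) := by rw [hv]
    push_cast at this
    simpa using this
  rw [hcast, ZMod.val_natCast, Nat.mod_eq_of_lt hvn]
  have hl : 0 < l := by omega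
  rw [Nat.div_eq_iff hl]
  have hc : l * (y.val / l) = y.val / l * l := mul_comm _ _
  constructor <;> omega

theorem mbInt_card (n : ℕ) [NeZero n] (l Δ : ℕ) (hl : 0 < l) :
    {y : ZMod n | ¬ mbInt n l Δ y}.ncard ≤ 2 * Δ * (n / l + 1) + Δ := by
  classical
  let φ : ZMod n → (ℕ × ℕ) := fun y => (y.val / l, y.val % l)
  have hinjφ : Function.Injective φ := by
    intro x y hxy
    have h1 : x.val / l = y.val / l := congrArg Prod.fst hxy
    have h2 : x.val % l = y.val % l := congrArg Prod.snd hxy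
    apply ZMod.val_injective n
    rw [← Nat.div_add_mod x.val l, ← Nat.div_add_mod y.val l, h1, h2]
  let A : Finset (ℕ × ℕ) := Finset.range (n / l + 1) ×ˢ (Finset.range Δ ∪ Finset.Ico (l - Δ) l)
  have hA : A.card ≤ 2 * Δ * (n / l + 1) := by
    simp only [A, Finset.card_product, Finset.card_range]
    rw [mul_comm]
    apply Nat.mul_le_mul_right
    refine (Finset.card_union_le _ _).trans ?_
    simp
    omega
  have hsub : {y : ZMod n | ¬ mbInt n l Δ y} ⊆ (φ ⁻¹' (A : Set (ℕ × ℕ))) ∪ (ZMod.val ⁻¹' ((Finset.Ico (n - Δ) n : Finset ℕ) : Set ℕ)) := by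
    intro y hy
    have hy' : ¬ mbInt n l Δ y := hy
    have hv := ZMod.val_lt y
    have hm := Nat.mod_lt y.val hl
    have hd : y.val / l ≤ n / l := Nat.div_le_div_right hv.le
    by_cases h3 : y.val + Δ < n
    · left
      simp only [Set.mem_preimage, φ, A, Finset.coe_product, Set.mem_prod, Finset.mem_coe, Finset.mem_range, Finset.mem_union, Finset.mem_Ico]
      refine ⟨by omega, ?_⟩
      by_contra hc
      apply hy'
      refine ⟨by omega, by omega, h3⟩
    · right
      simp only [Set.mem_preimage, Finset.mem_coe, Finset.mem_Ico]
      omega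
  have hp1 : (φ ⁻¹' (A : Set (ℕ × ℕ))).ncard ≤ A.card := by
    rw [← Set.ncard_coe_finset, ← Set.ncard_image_of_injective _ hinjφ]
    exact Set.ncard_le_ncard (Set.image_preimage_subset _ _) (Finset.finite_toSet _)
  have hp2 : (ZMod.val ⁻¹' ((Finset.Ico (n - Δ) n : Finset ℕ) : Set ℕ) : Set (ZMod n)).ncard ≤ Δ := by
    rw [← Set.ncard_image_of_injective _ (ZMod.val_injective n)]
    refine (Set.ncard_le_ncard (Set.image_preimage_subset _ _) (Finset.finite_toSet _)).trans ?_
    rw [Set.ncard_coe_finset]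
    simp
    omega
  calc _ ≤ _ := Set.ncard_le_ncard hsub (Set.toFinite _)
    _ ≤ _ := Set.ncard_union_le _ _
    _ ≤ _ := by omega

theorem mb_pow_ne (p q : ℤ) (J : ℕ) (hq : 2 ≤ |q|) (hp : |q| ^ J < |p|) (i j i' j' : ℕ)
    (hj : j < J) (hj' : j' < J) (h : p ^ i * q ^ j = p ^ i' * q ^ j') : i = i' ∧ j = j' := by
  have habs : |p| ^ i * |q| ^ j = |p| ^ i' * |q| ^ j' := by
    rw [← abs_pow, ← abs_pow, ← abs_pow, ← abs_pow, ← abs_mul, ← abs_mul, h]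
  have hq0 : 0 < |q| := by omega
  have hp0 : 0 < |p| := lt_of_le_of_lt (by positivity) hp
  have key : ∀ i j i' j' : ℕ, j' < J → |p| ^ i * |q| ^ j = |p| ^ i' * |q| ^ j' → i ≤ i' := by
    intro i j i' j' hj' h
    by_contra hlt
    push Not at hlt
    have h1 : |q| ^ j' < |p| := lt_of_le_of_lt (pow_le_pow_right₀ (by omega) hj'.le) hp
    have h2 : |p| ^ i' * |p| ≤ |p| ^ i := by
      rw [← pow_succ]; exact pow_le_pow_right₀ (by omega) hlt
    have h3 : |p| ^ i ≤ |p| ^ i * |q| ^ j := le_mul_of_one_le_right (by positivity) (one_le_pow₀ (by omega))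
    have h4 : |p| ^ i' * |q| ^ j' < |p| ^ i' * |p| := mul_lt_mul_of_pos_left h1 (by positivity)
    linarith
  have hi : i = i' := le_antisymm (key _ _ _ _ hj' habs) (key _ _ _ _ hj habs.symm)
  subst hi
  refine ⟨rfl, ?_⟩
  have := mul_left_cancel₀ (by positivity) habs
  exact pow_right_injective₀ (by omega) (by omega) this

theorem mb_isUnit (p : ℤ) (n : ℕ) (h : Int.gcd p n = 1) : IsUnit (p : ZMod n) := by
  rw [ZMod.coe_int_isUnit_iff_isCoprime]
  exact (Int.isCoprime_iff_gcd_eq_one.mpr h).symm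

/-- generic points: the first `J × J` translates lie in different blocks -/
def mbGen (n : ℕ) (p q : ℤ) (l J : ℕ) (x : ZMod n) : Prop :=
  ∀ i < J, ∀ j < J, ∀ i' < J, ∀ j' < J,
    (((p ^ i * q ^ j : ℤ) : ZMod n) * x).val / l = (((p ^ i' * q ^ j' : ℤ) : ZMod n) * x).val / l →
      i = i' ∧ j = j'

theorem mb_abs_pq (p q : ℤ) (J i j : ℕ) (hq : 2 ≤ |q|) (hqp : |q| ≤ |p|) (hi : i < J) (hj : j < J) :
    |p ^ i * q ^ j| ≤ |p| ^ (2 * J) := by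
  rw [abs_mul, abs_pow, abs_pow]
  calc |p| ^ i * |q| ^ j ≤ |p| ^ i * |p| ^ j := by gcongr
    _ = |p| ^ (i + j) := by rw [pow_add]
    _ ≤ _ := pow_le_pow_right₀ (by omega) (by omega)

theorem mbGen_card (n : ℕ) [NeZero n] (p q : ℤ) (l J : ℕ) (hl : 0 < l) (hln : l ≤ n)
    (hq : 2 ≤ |q|) (hp : |q| ^ J < |p|) (hqp : |q| ≤ |p|) :
    {x : ZMod n | ¬ mbGen n p q l J x}.ncard ≤ J ^ 4 * (14 * l * p.natAbs ^ (2 * J)) := by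
  classical
  let U := (((Finset.range J ×ˢ Finset.range J) ×ˢ (Finset.range J ×ˢ Finset.range J)).filter
    (fun u => u.1 ≠ u.2))
  let B : (ℕ × ℕ) × (ℕ × ℕ) → Set (ZMod n) := fun u =>
    {x | (((p ^ u.1.1 * q ^ u.1.2 : ℤ) : ZMod n) * x).val / l = (((p ^ u.2.1 * q ^ u.2.2 : ℤ) : ZMod n) * x).val / l}
  have hsub : {x : ZMod n | ¬ mbGen n p q l J x} ⊆ ⋃ u ∈ U, B u := by
    intro x hx
    have hx' : ¬ mbGen n p q l J x := hx
    unfold mbGen at hx'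
    push Not at hx'
    obtain ⟨i, hi, j, hj, i', hi', j', hj', h, hne⟩ := hx'
    simp only [Set.mem_iUnion]
    refine ⟨((i, j), (i', j')), ?_, h⟩
    simp only [U, Finset.mem_filter, Finset.mem_product, Finset.mem_range]
    refine ⟨⟨⟨hi, hj⟩, hi', hj'⟩, ?_⟩
    intro heq
    simp only [Prod.mk.injEq] at heq
    exact hne heq.1 heq.2
  have hUc : U.card ≤ J ^ 4 := by
    refine (Finset.card_filter_le _ _).trans ?_
    simp only [Finset.card_product, Finset.card_range]
    exact le_of_eq (by ring)
  have hnat : ((p.natAbs : ℕ) : ℤ) = |p| := Int.natCast_natAbs p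
  have hB : ∀ u ∈ U, (B u).ncard ≤ 14 * l * p.natAbs ^ (2 * J) := by
    rintro ⟨⟨i, j⟩, ⟨i', j'⟩⟩ hu
    simp only [U, Finset.mem_filter, Finset.mem_product, Finset.mem_range] at hu
    obtain ⟨⟨⟨hi, hj⟩, hi', hj'⟩, hne⟩ := hu
    refine (mb_coll_card n l (2 * p.natAbs ^ (2 * J)) hl hln (p ^ i * q ^ j) (p ^ i' * q ^ j') ?_ ?_).trans ?_
    · intro h
      apply hne
      have := mb_pow_ne p q J hq hp i j i' j' hj hj' h
      rw [this.1, this.2]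
    · have h1 := mb_abs_pq p q J i j hq hqp hi hj
      have h2 := mb_abs_pq p q J i' j' hq hqp hi' hj'
      push_cast
      refine (abs_sub _ _).trans ?_
      linarith
    · have : 1 ≤ p.natAbs ^ (2 * J) := Nat.one_le_pow _ _ (by omega)
      nlinarith
  calc _ ≤ _ := Set.ncard_le_ncard hsub (Set.toFinite _)
    _ ≤ ∑ u ∈ U, (B u).ncard := Finset.set_ncard_biUnion_le _ _
    _ ≤ ∑ u ∈ U, 14 * l * p.natAbs ^ (2 * J) := Finset.sum_le_sum hB
    _ ≤ _ := by rw [Finset.sum_const, smul_eq_mul]; exact Nat.mul_le_mul_right _ hUc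

/-- multiplication by a unit as a permutation -/
noncomputable def mbMul (n : ℕ) (p : ℤ) (h : IsUnit (p : ZMod n)) : Equiv.Perm (ZMod n) :=
  Units.mulLeft h.unit

theorem mbMul_pow (n : ℕ) (p : ℤ) (h : IsUnit (p : ZMod n)) (i : ℕ) (x : ZMod n) :
    ((mbMul n p h) ^ i) x = (p : ZMod n) ^ i * x := by
  induction i with
  | zero => simp
  | succ i ih =>
    rw [pow_succ', Equiv.Perm.mul_apply, ih]
    simp [mbMul]
    ring

theorem mb_rok_core (n : ℕ) [NeZero n] (p q : ℤ) (hpu : IsUnit (p : ZMod n)) (hqu : IsUnit (q : ZMod n))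
    (m D T J : ℕ) (hm : 0 < m) (hT : 0 < T) (hJ : J = T ^ 5 + T ^ 3 + m + 1)
    (hq : 2 ≤ |q|) (hp : |q| ^ J < |p|) (hqp : |q| ≤ |p|)
    (hn : p.natAbs ^ (D + 4 * J + 2) ≤ n) :
    ∃ R R0 : Set (ZMod n),
      (∀ r ∈ R, ∀ r' ∈ R, ∀ a < m, ∀ b < m, ∀ a' < m, ∀ b' < m,
        (q : ZMod n) ^ a * (p : ZMod n) ^ b * r = (q : ZMod n) ^ a' * (p : ZMod n) ^ b' * r' →
          r = r' ∧ a = a' ∧ b = b') ∧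
      (∀ x ∈ R0, ∀ d : ℤ, |d| ≤ |p| ^ D → x + (d : ZMod n) ∈ R) ∧
      (n : ℝ) ≤ (m * m : ℕ) * (R0.ncard : ℝ) +
        n * ((m + 1) * (2 * m + 1) * ((2 * m + 6) / T + 28 * J ^ 4 / p.natAbs) + m * m * (5 * J ^ 2 / p.natAbs)) := by
  classical
  have hn0 : 0 < n := Nat.pos_of_neZero n
  set P := mbMul n p hpu with hP
  set Q := mbMul n q hqu with hQ
  have hQP : ∀ i j x, (Q ^ j) ((P ^ i) x) = ((p ^ i * q ^ j : ℤ) : ZMod n) * x := by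
    intro i j x
    rw [hP, hQ, mbMul_pow, mbMul_pow]; push_cast; ring
  have hPQ : Commute P Q := by
    refine Equiv.ext fun x => ?_
    have h1 := mbMul_pow n p hpu 1
    have h2 := mbMul_pow n q hqu 1
    simp only [pow_one] at h1 h2
    simp only [Equiv.Perm.mul_apply, hP, hQ, h1, h2]
    ring
  set a := p.natAbs with ha
  have hac : (a : ℤ) = |p| := Int.natCast_natAbs p
  have ha2 : 2 ≤ a := by omega
  set l := a ^ (D + 2 * J + 1) with hl
  set Δ := a ^ (D + 2 * J) with hΔ
  have hl0 : 0 < l := by positivity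
  have hln : l ≤ n := le_trans (Nat.pow_le_pow_right (by omega) (by omega)) hn
  -- blocks
  let blk : ZMod n → Fin n := fun x => ⟨x.val / l, lt_of_le_of_lt (Nat.div_le_self _ _) (ZMod.val_lt x)⟩
  have hblk : ∀ x y, blk x = blk y ↔ x.val / l = y.val / l := by
    intro x y; simp [blk]
  let Gf : Finset (ZMod n) := Finset.univ.filter (mbGen n p q l J)
  let S1 : ZMod n → Finset (Fin n) := fun x =>
    (Finset.Icc 1 (T ^ 3) ×ˢ Finset.range (T ^ 3)).image (fun u => blk ((Q ^ u.2) ((P ^ u.1) x)))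
  let S2 : ZMod n → Finset (Fin n) := fun x =>
    (Finset.Icc 1 (T ^ 5)).image (fun j => blk ((Q ^ j) x))
  have hS1 : ∀ x ∈ Gf, (S1 x).card = T ^ 6 := by
    intro x hx
    have hg : mbGen n p q l J x := (Finset.mem_filter.mp hx).2
    simp only [S1]
    rw [Finset.card_image_of_injOn, Finset.card_product, Nat.card_Icc, Finset.card_range]
    · rw [Nat.add_sub_cancel]; ring
    · rintro ⟨i, j⟩ hu ⟨i', j'⟩ hu' h
      simp only [Finset.coe_product, Set.mem_prod, Finset.coe_Icc, Set.mem_Icc, Finset.mem_coe, Finset.mem_range] at hu hu'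
      simp only [hblk, hQP] at h
      have := hg i (by omega) j (by omega) i' (by omega) j' (by omega) h
      rw [this.1, this.2]
  have hS2 : ∀ x ∈ Gf, (S2 x).card = T ^ 5 := by
    intro x hx
    have hg : mbGen n p q l J x := (Finset.mem_filter.mp hx).2
    simp only [S2]
    rw [Finset.card_image_of_injOn, Nat.card_Icc]
    · rw [Nat.add_sub_cancel]
    · intro j hu j' hu' h
      simp only [Finset.coe_Icc, Set.mem_Icc] at hu hu'
      have h1 : ∀ j, (Q ^ j) x = ((p ^ 0 * q ^ j : ℤ) : ZMod n) * x := by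
        intro j; rw [← hQP]; simp
      simp only [hblk, h1] at h
      exact (hg 0 (by omega) j (by omega) 0 (by omega) j' (by omega) h).2
  obtain ⟨E0, hE0⟩ := mb_random blk (T ^ 4 - 1) (T ^ 3 + 1 + 2 * (T ^ 3 + m)) (T ^ 6) (T ^ 5) Gf S1 S2 hS1 hS2
  set E : Set (ZMod n) := {x | blk x ∈ E0} with hE
  set R := mbRok P Q E (T ^ 3) (T ^ 3 + m) (T ^ 5 + m) m with hR
  let Bd : Set (ZMod n) := ⋃ u ∈ Finset.range J ×ˢ Finset.range J, {x | (Q ^ u.2 * P ^ u.1) x ∈ {y | ¬ mbInt n l Δ y}}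
  refine ⟨R, R \ Bd, ?_, ?_, ?_⟩
  · intro r hr r' hr' b hb c hc b' hb' c' hc' h
    apply mbRok_disj hr hr' hb hc hb' hc'
    rw [hP, hQ]
    simp only [mbMul_pow]
    rw [← mul_assoc, ← mul_assoc, mul_comm ((p : ZMod n) ^ c), mul_comm ((p : ZMod n) ^ c')]
    exact h
  · intro x hx d hd
    refine mbRok_local hPQ (J := J) (by omega) (by omega) (by omega) ?_ hx.1
    intro i hi j hj
    have hxint : mbInt n l Δ ((Q ^ j) ((P ^ i) x)) := by
      by_contra hc
      apply hx.2
      simp only [Bd, Set.mem_iUnion]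
      exact ⟨(i, j), by simp [hi, hj], hc⟩
    have hsh : (Q ^ j) ((P ^ i) (x + (d : ZMod n))) = (Q ^ j) ((P ^ i) x) + ((p ^ i * q ^ j * d : ℤ) : ZMod n) := by
      rw [hQP, hQP]; push_cast; ring
    have hbe : blk ((Q ^ j) ((P ^ i) (x + (d : ZMod n)))) = blk ((Q ^ j) ((P ^ i) x)) := by
      rw [hblk, hsh]
      apply mbInt_shift n l Δ _ hxint
      rw [abs_mul, hΔ]
      push_cast
      rw [hac, pow_add, mul_comm]
      exact mul_le_mul hd (mb_abs_pq p q J i j hq hqp hi hj) (abs_nonneg _) (by positivity)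
    simp only [hE]
    show blk _ ∈ E0 ↔ blk _ ∈ E0
    rw [hbe]
  · have c1 : n ≤ m * m * R.ncard + (m + 1) * (2 * m + 1) * (mbZ0 P Q E (T ^ 3) (T ^ 3 + m) (T ^ 3) (T ^ 5)).ncard := by
      have := mbRok_card (E := E) (W := T ^ 3) (N1 := T ^ 3) (N2 := T ^ 5) hPQ hm
      rwa [Nat.card_zmod] at this
    have c2 := mbZ0_card (E := E) (W := T ^ 3) (N := T ^ 3 + m) (N1 := T ^ 3) (N2 := T ^ 5) hPQ
    have c3 := mbGen_card n p q l J hl0 hln hq hp hqp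
    set NG := {x : ZMod n | ¬ mbGen n p q l J x} with hNG
    have c4 : {x | ∀ i, 1 ≤ i → i ≤ T ^ 3 → ∀ j < T ^ 3, (Q ^ j) ((P ^ i) x) ∉ E}.ncard ≤
        {x | x ∈ Gf ∧ ∀ b ∈ S1 x, b ∉ E0}.ncard + NG.ncard := by
      refine le_trans (Set.ncard_le_ncard ?_ (Set.toFinite _)) (Set.ncard_union_le _ _)
      intro x hx
      by_cases hg : mbGen n p q l J x
      · left
        refine ⟨by simp [Gf, hg], ?_⟩
        intro b hb
        simp only [S1, Finset.mem_image, Finset.mem_product, Finset.mem_Icc, Finset.mem_range] at hb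
        obtain ⟨u, ⟨⟨h1, h2⟩, h3⟩, rfl⟩ := hb
        exact hx u.1 h1 h2 u.2 h3
      · right; exact hg
    have c5 : {x | ∀ j, 1 ≤ j → j ≤ T ^ 5 → (Q ^ j) x ∉ E}.ncard ≤
        {x | x ∈ Gf ∧ ∀ b ∈ S2 x, b ∉ E0}.ncard + NG.ncard := by
      refine le_trans (Set.ncard_le_ncard ?_ (Set.toFinite _)) (Set.ncard_union_le _ _)
      intro x hx
      by_cases hg : mbGen n p q l J x
      · left
        refine ⟨by simp [Gf, hg], ?_⟩
        intro b hb
        simp only [S2, Finset.mem_image, Finset.mem_Icc] at hb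
        obtain ⟨u, ⟨h1, h2⟩, rfl⟩ := hb
        exact hx u h1 h2
      · right; exact hg
    have c6 : Bd.ncard ≤ J ^ 2 * (2 * Δ * (n / l + 1) + Δ) := by
      refine (Finset.set_ncard_biUnion_le _ _).trans ?_
      refine (Finset.sum_le_sum (g := fun _ => (2 * Δ * (n / l + 1) + Δ)) ?_).trans ?_
      · intro u _
        rw [mb_ncard_pre]
        exact mbInt_card n l Δ hl0
      · rw [Finset.sum_const, Finset.card_product, Finset.card_range, smul_eq_mul, pow_two]
    have c7 : R.ncard ≤ (R \ Bd).ncard + Bd.ncard := Set.ncard_le_ncard_sdiff_add_ncard _ _ (Set.toFinite _)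
    -- real estimates
    have ha0 : (0 : ℝ) < a := by exact_mod_cast (by omega : 0 < a)
    have hnr : (0 : ℝ) < n := by exact_mod_cast hn0
    have hTr : (1 : ℝ) ≤ T := by exact_mod_cast hT
    have hΔa : (l : ℝ) = Δ * a := by
      rw [hl, hΔ, pow_succ]; push_cast; ring
    have hΔ0 : (0 : ℝ) < Δ := by rw [hΔ]; push_cast; positivity
    have d3 : (NG.ncard : ℝ) ≤ n * (14 * J ^ 4 / a) := by
      have h1 : (NG.ncard : ℝ) ≤ J ^ 4 * (14 * l * a ^ (2 * J)) := by exact_mod_cast c3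
      have h2 : (a : ℝ) ^ (D + 4 * J + 2) ≤ n := by exact_mod_cast hn
      have h3 : (l : ℝ) * a ^ (2 * J) * a = a ^ (D + 4 * J + 2) := by
        rw [hl]; push_cast; ring
      rw [← mul_div_assoc, le_div_iff₀ ha0]
      calc _ ≤ (J : ℝ) ^ 4 * (14 * l * a ^ (2 * J)) * a := by gcongr
        _ = 14 * J ^ 4 * (l * a ^ (2 * J) * a) := by ring
        _ ≤ 14 * J ^ 4 * n := by rw [h3]; gcongr
        _ = _ := by ring
    have d6 : (Bd.ncard : ℝ) ≤ n * (5 * J ^ 2 / a) := by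
      have h1 : (Bd.ncard : ℝ) ≤ J ^ 2 * (2 * Δ * ((n / l : ℕ) + 1) + Δ) := by exact_mod_cast c6
      have h2 : ((n / l : ℕ) : ℝ) ≤ n / l := Nat.cast_div_le
      have h3 : (l : ℝ) ≤ n := by exact_mod_cast hln
      have h4 : (n / l : ℝ) * Δ = n / a := by rw [hΔa]; field_simp
      have h5 : (Δ : ℝ) ≤ n / a := by rw [le_div_iff₀ ha0, ← hΔa]; exact h3
      calc _ ≤ _ := h1
        _ ≤ (J : ℝ) ^ 2 * (2 * Δ * ((n / l) + 1) + Δ) := by gcongr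
        _ = (J : ℝ) ^ 2 * (2 * (n / l * Δ) + 3 * Δ) := by ring
        _ ≤ (J : ℝ) ^ 2 * (2 * (n / a) + 3 * (n / a)) := by rw [h4]; gcongr
        _ = _ := by ring
    have d0 : ((T ^ 4 - 1 : ℕ) : ℝ) + 1 = (T : ℝ) ^ 4 := by
      rw [Nat.cast_sub (Nat.one_le_pow _ _ hT)]; push_cast; ring
    rw [d0, ZMod.card] at hE0
    have dT : ((T ^ 3 + 1 + 2 * (T ^ 3 + m) : ℕ) : ℝ) / T ^ 4 + (T : ℝ) ^ 4 / (T ^ 4 + (T ^ 6 : ℕ)) + (T : ℝ) ^ 4 / (T ^ 4 + (T ^ 5 : ℕ)) ≤ (2 * m + 6) / T := by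
      have hT0 : (0 : ℝ) < T := by linarith
      have t1 : ((T ^ 3 + 1 + 2 * (T ^ 3 + m) : ℕ) : ℝ) / T ^ 4 ≤ (2 * m + 4) / T := by
        rw [div_le_div_iff₀ (by positivity) hT0]
        push_cast
        have : (1 : ℝ) ≤ (T : ℝ) ^ 3 := one_le_pow₀ hTr
        have hm0 : (0 : ℝ) ≤ m := by positivity
        have h1 : ((T : ℝ) ^ 3 + 1 + 2 * (T ^ 3 + m)) ≤ (2 * m + 4) * T ^ 3 := by nlinarith
        calc _ ≤ (2 * m + 4) * (T : ℝ) ^ 3 * T := by gcongr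
          _ = _ := by ring
      have t2 : (T : ℝ) ^ 4 / (T ^ 4 + (T ^ 6 : ℕ)) ≤ 1 / T := by
        rw [div_le_div_iff₀ (by positivity) hT0]
        push_cast
        have : (T : ℝ) ^ 5 ≤ T ^ 6 := pow_le_pow_right₀ hTr (by omega)
        have : (0 : ℝ) < T ^ 4 := by positivity
        nlinarith
      have t3 : (T : ℝ) ^ 4 / (T ^ 4 + (T ^ 5 : ℕ)) ≤ 1 / T := by
        rw [div_le_div_iff₀ (by positivity) hT0]
        push_cast
        have : (0 : ℝ) < T ^ 4 := by positivity
        nlinarith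
      calc _ ≤ (2 * m + 4 : ℝ) / T + 1 / T + 1 / T := by gcongr
        _ = _ := by ring
    set e1 := {x | x ∈ Gf ∧ ∀ b ∈ S1 x, b ∉ E0}.ncard
    set e2 := {x | x ∈ Gf ∧ ∀ b ∈ S2 x, b ∉ E0}.ncard
    have dZ : ((mbZ0 P Q E (T ^ 3) (T ^ 3 + m) (T ^ 3) (T ^ 5)).ncard : ℝ) ≤ n * ((2 * m + 6) / T + 28 * J ^ 4 / a) := by
      have h1 : (mbZ0 P Q E (T ^ 3) (T ^ 3 + m) (T ^ 3) (T ^ 5)).ncard ≤ (T ^ 3 + 1 + 2 * (T ^ 3 + m)) * E.ncard + (e1 + NG.ncard) + (e2 + NG.ncard) := by omega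
      have h2 : ((mbZ0 P Q E (T ^ 3) (T ^ 3 + m) (T ^ 3) (T ^ 5)).ncard : ℝ) ≤ ((T ^ 3 + 1 + 2 * (T ^ 3 + m) : ℕ) : ℝ) * E.ncard + (e1 + NG.ncard) + (e2 + NG.ncard) := by exact_mod_cast h1
      have h3 := mul_le_mul_of_nonneg_left dT hnr.le
      have h4 : (n : ℝ) * ((2 * m + 6) / T + 28 * J ^ 4 / a) = n * ((2 * m + 6) / T) + 2 * (n * (14 * J ^ 4 / a)) := by ring
      linarith
    have f1 : (n : ℝ) ≤ (m * m : ℕ) * (R.ncard : ℝ) + (m + 1) * (2 * m + 1) * (mbZ0 P Q E (T ^ 3) (T ^ 3 + m) (T ^ 3) (T ^ 5)).ncard := by exact_mod_cast c1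
    have f2 : (R.ncard : ℝ) ≤ (R \ Bd).ncard + Bd.ncard := by exact_mod_cast c7
    have f3 : (R.ncard : ℝ) ≤ (R \ Bd).ncard + n * (5 * J ^ 2 / a) := by linarith
    calc (n : ℝ) ≤ _ := f1
      _ ≤ (m * m : ℕ) * ((R \ Bd).ncard + n * (5 * J ^ 2 / a)) + (m + 1) * (2 * m + 1) * (n * ((2 * m + 6) / T + 28 * J ^ 4 / a)) := by gcongr
      _ = _ := by push_cast; ring

theorem mb_rokhlin (m D : ℕ) (hm : 0 < m) (δ : ℝ) (hδ : 0 < δ) :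
    ∃ C : ℕ, ∀ (p q : ℤ) (n : ℕ), 0 < n → Int.gcd p n = 1 → Int.gcd q n = 1 →
      (C : ℤ) < |q| → |q| ^ C < |p| → |p| ^ C < (n : ℤ) →
    ∃ R R0 : Set (ZMod n),
      (∀ r ∈ R, ∀ r' ∈ R, ∀ a < m, ∀ b < m, ∀ a' < m, ∀ b' < m,
        (q : ZMod n) ^ a * (p : ZMod n) ^ b * r = (q : ZMod n) ^ a' * (p : ZMod n) ^ b' * r' →
          r = r' ∧ a = a' ∧ b = b') ∧
      (∀ x ∈ R0, ∀ d : ℤ, |d| ≤ |p| ^ D → x + (d : ZMod n) ∈ R) ∧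
      (1 - δ) * (n : ℝ) ≤ (m * m : ℕ) * (R0.ncard : ℝ) := by
  obtain ⟨T, hT⟩ := exists_nat_gt (2 * ((m + 1) * (2 * m + 1) * (2 * m + 6)) / δ)
  have hT0r : (0 : ℝ) < T := lt_of_le_of_lt (by positivity) hT
  have hT0 : 0 < T := by exact_mod_cast hT0r
  set J := T ^ 5 + T ^ 3 + m + 1 with hJ
  set A : ℝ := (m + 1) * (2 * m + 1) * (28 * J ^ 4) + m * m * (5 * J ^ 2) with hA
  obtain ⟨C0, hC0⟩ := exists_nat_gt (2 * A / δ)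
  refine ⟨C0 + (D + 4 * J + 2), ?_⟩
  set C := C0 + (D + 4 * J + 2) with hC
  intro p q n hn hpn hqn hq hp hpn'
  have : NeZero n := ⟨hn.ne'⟩
  have hq2 : 2 ≤ |q| := by omega
  have hqp : |q| ≤ |p| := by
    have : |q| ^ 1 ≤ |q| ^ C := pow_le_pow_right₀ (by omega) (by omega)
    rw [pow_one] at this
    omega
  have hpJ : |q| ^ J < |p| := lt_of_le_of_lt (pow_le_pow_right₀ (by omega) (by omega)) hp
  have hna : p.natAbs ^ (D + 4 * J + 2) ≤ n := by
    have h1 : |p| ^ (D + 4 * J + 2) ≤ |p| ^ C := pow_le_pow_right₀ (by omega) (by omega)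
    have h2 : ((p.natAbs ^ (D + 4 * J + 2) : ℕ) : ℤ) ≤ n := by
      push_cast
      omega
    exact_mod_cast h2
  obtain ⟨R, R0, h1, h2, h3⟩ := mb_rok_core n p q (mb_isUnit p n hpn) (mb_isUnit q n hqn) m D T J hm hT0 hJ hq2 hpJ hqp hna
  refine ⟨R, R0, h1, h2, ?_⟩
  have hCa : (C0 : ℝ) ≤ p.natAbs := by
    have h0 : ((p.natAbs : ℕ) : ℤ) = |p| := Int.natCast_natAbs p
    have : C0 ≤ p.natAbs := by omega
    exact_mod_cast this
  have hnr : (0 : ℝ) < n := by exact_mod_cast hn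
  have hA0 : 0 ≤ A := by positivity
  have ha0 : (0 : ℝ) < p.natAbs := lt_of_lt_of_le (lt_of_le_of_lt (by positivity) hC0) hCa
  have e1 : (m + 1) * (2 * m + 1) * (2 * m + 6) / (T : ℝ) ≤ δ / 2 := by
    rw [div_lt_iff₀ hδ] at hT
    rw [div_le_iff₀ hT0r]
    linarith
  have e2 : A / p.natAbs ≤ δ / 2 := by
    rw [div_lt_iff₀ hδ] at hC0
    rw [div_le_iff₀ ha0]
    nlinarith
  have e3 : ((m + 1) * (2 * m + 1) * ((2 * m + 6) / T + 28 * J ^ 4 / p.natAbs) + m * m * (5 * J ^ 2 / p.natAbs) : ℝ) = (m + 1) * (2 * m + 1) * (2 * m + 6) / (T : ℝ) + A / p.natAbs := by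
    rw [hA]; ring
  have hJr : ((T ^ 5 + T ^ 3 + m + 1 : ℕ) : ℝ) = (J : ℝ) := by rw [hJ]
  rw [e3] at h3
  have : (n : ℝ) * ((m + 1) * (2 * m + 1) * (2 * m + 6) / (T : ℝ) + A / p.natAbs) ≤ n * δ := by
    apply mul_le_mul_of_nonneg_left _ hnr.le
    linarith
  linarith

/-- step sizes -/
def mbS (p q : ℤ) (m' i j : ℕ) : ℤ := (1 - p) * q ^ (m' - i) * p ^ (m' - j)

/-- offsets -/
def mbG (p q : ℤ) (m' u : ℕ) : ℤ := p ^ (m' + 1) * ∑ i ∈ Finset.range u, q ^ (m' - i)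

/-- the fibre type -/
abbrev mbF (m' L : ℕ) : Type := Fin (m' + 1) × Fin (m' + 1) × (Fin (m' + 1) → Fin m' → ZMod L)

/-- total lamp displacement -/
def mbH (p q : ℤ) (m' L : ℕ) (h : Fin (m' + 1) → Fin m' → ZMod L) : ℤ :=
  ∑ a : Fin (m' + 1) × Fin m', ((h a.1 a.2).val : ℤ) * mbS p q m' a.1 a.2

/-- the coordinate map -/
noncomputable def mbPhi (n : ℕ) (p q : ℤ) (m' L : ℕ) (w : mbF m' L) (z : ℤ) : ZMod n :=
  (q : ZMod n) ^ (w.1 : ℕ) * (p : ZMod n) ^ (w.2.1 : ℕ) *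
    ((((q : ZMod n) ^ (m' + 1) * (p : ZMod n) ^ (m' + 1))⁻¹) *
      ((z + mbG p q m' w.1 + mbH p q m' L w.2.2 : ℤ) : ZMod n))

theorem mbPhi_p (n : ℕ) (p q : ℤ) (m' L : ℕ) (u0 u1 u1' : Fin (m' + 1)) (h) (z : ℤ)
    (hu : (u1' : ℕ) = u1 + 1) :
    (p : ZMod n) * mbPhi n p q m' L (u0, u1, h) z = mbPhi n p q m' L (u0, u1', h) z := by
  simp only [mbPhi, hu]; ring

theorem mb_tele (p : ℤ) (m' u : ℕ) (hu : u ≤ m') :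
    ∑ j ∈ Finset.range u, (1 - p) * p ^ (m' - j) = p ^ (m' + 1 - u) - p ^ (m' + 1) := by
  induction u with
  | zero => simp
  | succ u ih =>
    rw [Finset.sum_range_succ, ih (by omega)]
    have h1 : m' + 1 - u = (m' - u) + 1 := by omega
    have h2 : m' + 1 - (u + 1) = m' - u := by omega
    rw [h1, h2]; ring

theorem mbPhi_q (n : ℕ) (p q : ℤ) (hpu : IsUnit (p : ZMod n)) (hqu : IsUnit (q : ZMod n))
    (m' L : ℕ) (u0 u0' u1 : Fin (m' + 1)) (h h') (z : ℤ)
    (hu : (u0' : ℕ) = u0 + 1)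
    (hh : ∀ (i : Fin (m' + 1)) (j : Fin m'), ((h' i j : ZMod L).val : ℤ) = ((h i j : ZMod L).val : ℤ) + if i = u0 ∧ (j : ℕ) < u1 then 1 else 0) :
    (q : ZMod n) * mbPhi n p q m' L (u0, u1, h) z + 1 = mbPhi n p q m' L (u0', u1, h') z := by
  have hH : mbH p q m' L h' = mbH p q m' L h + q ^ (m' - u0) * (p ^ (m' + 1 - u1) - p ^ (m' + 1)) := by
    have e1 : mbH p q m' L h' - mbH p q m' L h =
        ∑ i : Fin (m' + 1), ∑ j : Fin m', (if i = u0 ∧ (j : ℕ) < u1 then mbS p q m' i j else 0) := by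
      rw [mbH, mbH, ← Finset.sum_sub_distrib, Fintype.sum_prod_type]
      refine Finset.sum_congr rfl fun i _ => Finset.sum_congr rfl fun j _ => ?_
      rw [hh]
      split_ifs <;> ring
    have e2 : ∑ i : Fin (m' + 1), ∑ j : Fin m', (if i = u0 ∧ (j : ℕ) < u1 then mbS p q m' i j else 0) =
        ∑ j : Fin m', (if (j : ℕ) < u1 then mbS p q m' u0 j else 0) := by
      rw [Finset.sum_eq_single u0]
      · simp
      · intro i _ hi; simp [hi]
      · simp
    have e3 : ∑ j : Fin m', (if (j : ℕ) < u1 then mbS p q m' u0 j else 0) =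
        q ^ (m' - u0) * (p ^ (m' + 1 - u1) - p ^ (m' + 1)) := by
      rw [Fin.sum_univ_eq_sum_range (fun j => if j < (u1 : ℕ) then mbS p q m' u0 j else 0) m',
        ← mb_tele p m' u1 (by omega), ← Finset.sum_filter, Finset.mul_sum]
      have : (Finset.range m').filter (fun j => j < (u1 : ℕ)) = Finset.range u1 := by
        ext j; simp; omega
      rw [this]
      refine Finset.sum_congr rfl fun j _ => ?_
      rw [mbS]; ring
    linarith
  have hG : mbG p q m' (u0 + 1) = mbG p q m' u0 + p ^ (m' + 1) * q ^ (m' - u0) := by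
    rw [mbG, mbG, Finset.sum_range_succ]; ring
  simp only [mbPhi, hH, hu, hG]
  have hk : ((q : ZMod n) ^ (m' + 1) * (p : ZMod n) ^ (m' + 1)) * ((q : ZMod n) ^ (m' + 1) * (p : ZMod n) ^ (m' + 1))⁻¹ = 1 :=
    ZMod.mul_inv_of_unit _ ((hqu.pow _).mul (hpu.pow _))
  set κ := ((q : ZMod n) ^ (m' + 1) * (p : ZMod n) ^ (m' + 1))⁻¹
  have hq' : (q : ZMod n) ^ (m' + 1) = (q : ZMod n) ^ ((u0 : ℕ) + 1) * (q : ZMod n) ^ (m' - u0) := by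
    rw [← pow_add]; congr 1; omega
  have hp' : (p : ZMod n) ^ (m' + 1) = (p : ZMod n) ^ (u1 : ℕ) * (p : ZMod n) ^ (m' + 1 - u1) := by
    rw [← pow_add]; congr 1; omega
  have hk2 : (q : ZMod n) ^ ((u0 : ℕ) + 1) * (q : ZMod n) ^ (m' - u0) * ((p : ZMod n) ^ (u1 : ℕ) * (p : ZMod n) ^ (m' + 1 - u1)) * κ = 1 := by
    rw [← hq', ← hp']; exact hk
  push_cast
  rw [← hk2]
  ring

theorem mbS_abs (p q : ℤ) (m' i j : ℕ) : |mbS p q m' i j| = |1 - p| * |q| ^ (m' - i) * |p| ^ (m' - j) := by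
  rw [mbS, abs_mul, abs_mul, abs_pow, abs_pow]

theorem mb_one_sub_abs (p : ℤ) (hp : 2 ≤ |p|) : |1 - p| ≤ |p| * |p| := by
  have : |1 - p| ≤ |1| + |p| := abs_sub _ _
  rw [abs_one] at this
  nlinarith

theorem mbS_le (p q : ℤ) (m' i j : ℕ) (hq : 2 ≤ |q|) (hqp : |q| ≤ |p|) :
    |mbS p q m' i j| ≤ |p| ^ (2 * m' + 2) := by
  have h1 := mb_one_sub_abs p (by omega)
  have hp1 : 1 ≤ |p| := by omega
  rw [mbS_abs]
  calc _ ≤ (|p| * |p|) * |p| ^ m' * |p| ^ m' := by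
        have : |q| ^ (m' - i) ≤ |p| ^ m' := (pow_le_pow_left₀ (abs_nonneg _) hqp _).trans
          (pow_le_pow_right₀ hp1 (by omega))
        have : |p| ^ (m' - j) ≤ |p| ^ m' := pow_le_pow_right₀ hp1 (by omega)
        gcongr
    _ = _ := by ring

theorem mbS_sep (p q : ℤ) (m' : ℕ) (hq : 2 ≤ |q|) (hp : |q| ^ (m' + 1) ≤ |p|)
    (a b : Fin (m' + 1) × Fin m') (hab : a ≠ b) :
    |q| * |mbS p q m' a.1 a.2| ≤ |mbS p q m' b.1 b.2| ∨ |q| * |mbS p q m' b.1 b.2| ≤ |mbS p q m' a.1 a.2| := by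
  have hq0 : 0 < |q| := by omega
  have hp0 : 0 < |p| := lt_of_lt_of_le (by positivity) hp
  have key : ∀ i j i' j' : ℕ, i ≤ m' → i' ≤ m' → j < m' → j' < m' → (j' < j ∨ (j' = j ∧ i' < i)) →
      |q| * |mbS p q m' i j| ≤ |mbS p q m' i' j'| := by
    intro i j i' j' hi hi' hj hj' h
    rw [mbS_abs, mbS_abs]
    rcases h with h | ⟨rfl, h⟩
    · calc |q| * (|1 - p| * |q| ^ (m' - i) * |p| ^ (m' - j)) = |1 - p| * |q| ^ (m' - i + 1) * |p| ^ (m' - j) := by ring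
        _ ≤ |1 - p| * |q| ^ (m' + 1) * |p| ^ (m' - j) := by
          have : |q| ^ (m' - i + 1) ≤ |q| ^ (m' + 1) := pow_le_pow_right₀ (by omega) (by omega)
          gcongr
        _ ≤ |1 - p| * |p| * |p| ^ (m' - j) := by gcongr
        _ = |1 - p| * 1 * |p| ^ (m' - j + 1) := by ring
        _ ≤ _ := by
          have : 1 ≤ |q| ^ (m' - i') := one_le_pow₀ (by omega)
          have : |p| ^ (m' - j + 1) ≤ |p| ^ (m' - j') := pow_le_pow_right₀ (by omega) (by omega)
          gcongr
    · calc |q| * (|1 - p| * |q| ^ (m' - i) * |p| ^ (m' - j')) = |1 - p| * |q| ^ (m' - i + 1) * |p| ^ (m' - j') := by ring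
        _ ≤ _ := by
          have : |q| ^ (m' - i + 1) ≤ |q| ^ (m' - i') := pow_le_pow_right₀ (by omega) (by omega)
          gcongr
  obtain ⟨⟨i, hi⟩, ⟨j, hj⟩⟩ := a
  obtain ⟨⟨i', hi'⟩, ⟨j', hj'⟩⟩ := b
  have hne : ¬ (i = i' ∧ j = j') := by
    rintro ⟨rfl, rfl⟩; exact hab rfl
  simp only
  rcases lt_trichotomy j j' with h | h | h
  · right; exact key _ _ _ _ (by omega) (by omega) hj' hj (Or.inl h)
  · rcases lt_trichotomy i i' with h' | h' | h'
    · right; exact key _ _ _ _ (by omega) (by omega) hj' hj (Or.inr ⟨h, h'⟩)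
    · exact absurd ⟨h', h⟩ hne
    · left; exact key _ _ _ _ (by omega) (by omega) hj hj' (Or.inr ⟨h.symm, h'⟩)
  · left; exact key _ _ _ _ (by omega) (by omega) hj hj' (Or.inl h)

theorem mbG_le (p q : ℤ) (m' u : ℕ) (hu : u ≤ m' + 1) (hq : 2 ≤ |q|) (hqp : |q| ≤ |p|) :
    |mbG p q m' u| ≤ (m' + 1) * |p| ^ (2 * m' + 2) := by
  have hp1 : 1 ≤ |p| := by omega
  rw [mbG, abs_mul, abs_pow]
  have h1 : |∑ i ∈ Finset.range u, q ^ (m' - i)| ≤ (m' + 1) * |p| ^ m' := by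
    refine (Finset.abs_sum_le_sum_abs _ _).trans ?_
    calc _ ≤ ∑ i ∈ Finset.range u, |p| ^ m' := by
          apply Finset.sum_le_sum
          intro i _
          rw [abs_pow]
          exact (pow_le_pow_left₀ (abs_nonneg _) hqp _).trans (pow_le_pow_right₀ hp1 (by omega))
      _ = u * |p| ^ m' := by simp
      _ ≤ _ := by
        have : (u : ℤ) ≤ m' + 1 := by exact_mod_cast hu
        gcongr
  calc _ ≤ |p| ^ (m' + 1) * ((m' + 1) * |p| ^ m') := by gcongr
    _ = (m' + 1) * |p| ^ (2 * m' + 1) := by ring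
    _ ≤ _ := by
      have : |p| ^ (2 * m' + 1) ≤ |p| ^ (2 * m' + 2) := pow_le_pow_right₀ hp1 (by omega)
      gcongr

theorem mbH_sub_le (p q : ℤ) (m' L : ℕ) [NeZero L] (h h') (hq : 2 ≤ |q|) (hqp : |q| ≤ |p|) :
    |mbH p q m' L h - mbH p q m' L h'| ≤ ((m' + 1) * m' * L : ℕ) * |p| ^ (2 * m' + 2) := by
  rw [mbH, mbH, ← Finset.sum_sub_distrib]
  refine (Finset.abs_sum_le_sum_abs _ _).trans ?_
  calc _ ≤ ∑ a : Fin (m' + 1) × Fin m', (L : ℤ) * |p| ^ (2 * m' + 2) := by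
        apply Finset.sum_le_sum
        intro a _
        rw [← sub_mul, abs_mul]
        have h1 := ZMod.val_lt (h a.1 a.2)
        have h2 := ZMod.val_lt (h' a.1 a.2)
        have : |((h a.1 a.2).val : ℤ) - (h' a.1 a.2).val| ≤ L := by
          rw [abs_le]; constructor <;> omega
        have := mbS_le p q m' a.1 a.2 hq hqp
        gcongr
    _ = _ := by
      rw [Finset.sum_const, Finset.card_univ, Fintype.card_prod, Fintype.card_fin, Fintype.card_fin, nsmul_eq_mul]
      push_cast; ring

theorem mb_Z (n : ℕ) [NeZero n] (p q : ℤ) (hpu : IsUnit (p : ZMod n)) (hqu : IsUnit (q : ZMod n))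
    (m' L : ℕ) [NeZero L] (hq : 2 ≤ |q|) (hqL : (L : ℤ) ≤ |q|) (hp : |q| ^ (m' + 1) ≤ |p|)
    (hpL : (((m' + 1) * m' * L + (m' + 1) : ℕ) : ℤ) ≤ |p|)
    (hn : |p| ^ (2 * m' + 3) ≤ n) (δ : ℝ)
    (R R0 : Set (ZMod n))
    (hR : ∀ r ∈ R, ∀ r' ∈ R, ∀ a < m' + 1, ∀ b < m' + 1, ∀ a' < m' + 1, ∀ b' < m' + 1,
        (q : ZMod n) ^ a * (p : ZMod n) ^ b * r = (q : ZMod n) ^ a' * (p : ZMod n) ^ b' * r' →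
          r = r' ∧ a = a' ∧ b = b')
    (hR0 : ∀ x ∈ R0, ∀ d : ℤ, |d| ≤ |p| ^ (2 * m' + 3) → x + (d : ZMod n) ∈ R)
    (hc : (1 - δ) * (n : ℝ) ≤ ((m' + 1) * (m' + 1) : ℕ) * (R0.ncard : ℝ)) :
    ∃ Z : Finset ℤ, (∀ z ∈ Z, ∀ z' ∈ Z, ∀ w w' : mbF m' L,
        mbPhi n p q m' L w z = mbPhi n p q m' L w' z' → z = z' ∧ w = w') ∧
      (1 - δ - (((m' + 1) ^ 3 * m' * L : ℕ) : ℝ) / q.natAbs) * n ≤ (Z.card : ℝ) * Fintype.card (mbF m' L) := by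
  classical
  have hn0 : 0 < n := Nat.pos_of_neZero n
  have hL0 : 0 < L := Nat.pos_of_neZero L
  have hqc : ((q.natAbs : ℕ) : ℤ) = |q| := Int.natCast_natAbs q
  have hqp : |q| ≤ |p| := by
    refine le_trans ?_ hp
    exact le_self_pow₀ (by omega) (by omega)
  let s : Fin (m' + 1) × Fin m' → ℤ := fun a => mbS p q m' a.1 a.2
  have hs : ∀ a, s a ≠ 0 := by
    intro a
    have h1 : (1 - p) ≠ 0 := by
      intro h
      have : p = 1 := by omega
      rw [this] at hqp
      simp at hqp
      omega
    have h2 : q ≠ 0 := by rintro rfl; simp at hq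
    have h3 : p ≠ 0 := by rintro rfl; simp at hqp; exact h2 hqp
    exact mul_ne_zero (mul_ne_zero h1 (pow_ne_zero _ h2)) (pow_ne_zero _ h3)
  obtain ⟨E, hE1, hE2, hE3⟩ := mb_tile s L hL0 q.natAbs (by omega) (by omega) hs
    (by intro a b hab; rw [hqc]; exact mbS_sep p q m' hq hp a b hab) Finset.univ (n : ℤ) (by positivity)
    (by
      intro a _
      rw [hqc]
      have := mbS_le p q m' a.1 a.2 hq hqp
      calc |q| * |s a| ≤ |p| * |p| ^ (2 * m' + 2) := by gcongr
        _ = |p| ^ (2 * m' + 3) := by ring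
        _ ≤ _ := hn)
  let H := Fin (m' + 1) → Fin m' → ZMod L
  have hcr : ∀ h : H, ∀ a ∈ (Finset.univ : Finset (Fin (m' + 1) × Fin m')), (0:ℤ) ≤ ((h a.1 a.2).val : ℤ) ∧ ((h a.1 a.2).val : ℤ) < L := by
    intro h a _
    have := ZMod.val_lt (h a.1 a.2)
    omega
  have hE1' : ∀ z ∈ E, ∀ h : H, 0 ≤ z + mbH p q m' L h ∧ z + mbH p q m' L h < n := fun z hz h =>
    hE1 z hz (fun a => ((h a.1 a.2).val : ℤ)) (hcr h)
  have hE2' : ∀ z ∈ E, ∀ z' ∈ E, ∀ h h' : H, z + mbH p q m' L h = z' + mbH p q m' L h' → z = z' ∧ h = h' := by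
    intro z hz z' hz' h h' heq
    have := hE2 z hz z' hz' (fun a => ((h a.1 a.2).val : ℤ)) (fun a => ((h' a.1 a.2).val : ℤ)) (hcr h) (hcr h') heq
    refine ⟨this.1, ?_⟩
    funext i j
    have h2 := this.2 (i, j) (Finset.mem_univ _)
    simp only at h2
    exact ZMod.val_injective L (by exact_mod_cast h2)
  let ψ : ℤ × H → ZMod n := fun u => ((u.1 + mbH p q m' L u.2 : ℤ) : ZMod n)
  have hψ : ∀ z ∈ E, ∀ z' ∈ E, ∀ h h' : H, ψ (z, h) = ψ (z', h') → z = z' ∧ h = h' := by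
    intro z hz z' hz' h h' heq
    apply hE2' z hz z' hz'
    have h1 := hE1' z hz h
    have h2 := hE1' z' hz' h'
    have h3 := (ZMod.intCast_eq_intCast_iff _ _ _).mp heq
    rw [Int.ModEq, Int.emod_eq_of_lt h1.1 h1.2, Int.emod_eq_of_lt h2.1 h2.2] at h3
    exact h3
  let Z := E.filter (fun z => ∃ h : H, ψ (z, h) ∈ R0)
  refine ⟨Z, ?_, ?_⟩
  · -- all the points lie in R
    have hin : ∀ z ∈ Z, ∀ w : mbF m' L, ((z + mbG p q m' w.1 + mbH p q m' L w.2.2 : ℤ) : ZMod n) ∈ R := by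
      intro z hz w
      obtain ⟨_, h, hh⟩ := Finset.mem_filter.mp hz
      have := hR0 _ hh (mbG p q m' w.1 + (mbH p q m' L w.2.2 - mbH p q m' L h)) ?_
      · convert this using 1
        simp only [ψ]
        push_cast
        ring
      · have h1 := mbG_le p q m' w.1 (by omega) hq hqp
        have h2 := mbH_sub_le p q m' L w.2.2 h hq hqp
        refine (abs_add_le _ _).trans ?_
        calc _ ≤ (m' + 1) * |p| ^ (2 * m' + 2) + ((m' + 1) * m' * L : ℕ) * |p| ^ (2 * m' + 2) := by gcongr
          _ = (((m' + 1) * m' * L + (m' + 1) : ℕ) : ℤ) * |p| ^ (2 * m' + 2) := by push_cast; ring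
          _ ≤ |p| * |p| ^ (2 * m' + 2) := by gcongr
          _ = _ := by ring
    intro z hz z' hz' w w' heq
    obtain ⟨u0, u1, h⟩ := w
    obtain ⟨u0', u1', h'⟩ := w'
    have hk : ((q : ZMod n) ^ (m' + 1) * (p : ZMod n) ^ (m' + 1)) * ((q : ZMod n) ^ (m' + 1) * (p : ZMod n) ^ (m' + 1))⁻¹ = 1 :=
      ZMod.mul_inv_of_unit _ ((hqu.pow _).mul (hpu.pow _))
    simp only [mbPhi] at heq
    have h1 := hin z hz (u0, u1, h)
    have h2 := hin z' hz' (u0', u1', h')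
    simp only at h1 h2
    set κ := ((q : ZMod n) ^ (m' + 1) * (p : ZMod n) ^ (m' + 1))⁻¹
    set r := ((z + mbG p q m' u0 + mbH p q m' L h : ℤ) : ZMod n) with hr
    set r' := ((z' + mbG p q m' u0' + mbH p q m' L h' : ℤ) : ZMod n) with hr'
    have h3 : (q : ZMod n) ^ (u0 : ℕ) * (p : ZMod n) ^ (u1 : ℕ) * r = (q : ZMod n) ^ (u0' : ℕ) * (p : ZMod n) ^ (u1' : ℕ) * r' := by
      have h4 := congrArg (fun t => ((q : ZMod n) ^ (m' + 1) * (p : ZMod n) ^ (m' + 1)) * t) heq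
      calc _ = ((q : ZMod n) ^ (m' + 1) * (p : ZMod n) ^ (m' + 1) * κ) * ((q : ZMod n) ^ (u0 : ℕ) * (p : ZMod n) ^ (u1 : ℕ) * r) := by rw [hk, one_mul]
        _ = _ := by ring
        _ = _ := h4
        _ = ((q : ZMod n) ^ (m' + 1) * (p : ZMod n) ^ (m' + 1) * κ) * ((q : ZMod n) ^ (u0' : ℕ) * (p : ZMod n) ^ (u1' : ℕ) * r') := by ring
        _ = _ := by rw [hk, one_mul]
    obtain ⟨h5, h6, h7⟩ := hR r h1 r' h2 _ u0.2 _ u1.2 _ u0'.2 _ u1'.2 h3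
    have h6' : u0 = u0' := Fin.ext h6
    have h7' : u1 = u1' := Fin.ext h7
    subst h6' h7'
    have h8 : ψ (z, h) = ψ (z', h') := by
      simp only [ψ]
      rw [hr, hr'] at h5
      push_cast at h5 ⊢
      linear_combination h5
    obtain ⟨h9, h10⟩ := hψ z (Finset.mem_filter.mp hz).1 z' (Finset.mem_filter.mp hz').1 h h' h8
    rw [h9, h10]
    exact ⟨rfl, rfl⟩
  · have hcH : Fintype.card H = L ^ ((m' + 1) * m') := by
      simp only [H]
      rw [Fintype.card_fun, Fintype.card_fun, ZMod.card, Fintype.card_fin, Fintype.card_fin, ← pow_mul, mul_comm]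
    have hcF : Fintype.card (mbF m' L) = (m' + 1) * (m' + 1) * Fintype.card H := by
      rw [Fintype.card_prod, Fintype.card_prod, Fintype.card_fin]; ring
    -- covered points
    have hcov : (((E ×ˢ (Finset.univ : Finset H)).image ψ).card) = E.card * Fintype.card H := by
      rw [Finset.card_image_of_injOn, Finset.card_product, Finset.card_univ]
      rintro ⟨z, h⟩ hz ⟨z', h'⟩ hz' heq
      simp only [Finset.coe_product, Set.mem_prod, Finset.mem_coe] at hz hz'
      obtain ⟨a, b⟩ := hψ z hz.1 z' hz'.1 h h' heq
      rw [a, b]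
    have hR0c : R0.ncard + E.card * Fintype.card H ≤ Z.card * Fintype.card H + n := by
      have h1 : R0 ⊆ (((Z ×ˢ (Finset.univ : Finset H)).image ψ ∪ ((E ×ˢ (Finset.univ : Finset H)).image ψ)ᶜ : Finset (ZMod n)) : Set (ZMod n)) := by
        intro x hx
        simp only [Finset.mem_coe, Finset.mem_union, Finset.mem_compl]
        by_cases hxc : x ∈ (E ×ˢ (Finset.univ : Finset H)).image ψ
        · left
          obtain ⟨⟨z, h⟩, hu, rfl⟩ := Finset.mem_image.mp hxc
          refine Finset.mem_image.mpr ⟨(z, h), ?_, rfl⟩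
          simp only [Finset.mem_product, Finset.mem_univ, and_true] at hu ⊢
          exact Finset.mem_filter.mpr ⟨hu, h, hx⟩
        · right; exact hxc
      have h2 := Set.ncard_le_ncard h1 (Finset.finite_toSet _)
      rw [Set.ncard_coe_finset] at h2
      have h3 := Finset.card_union_le ((Z ×ˢ (Finset.univ : Finset H)).image ψ) (((E ×ˢ (Finset.univ : Finset H)).image ψ)ᶜ)
      have h4 : ((Z ×ˢ (Finset.univ : Finset H)).image ψ).card ≤ Z.card * Fintype.card H := by
        refine Finset.card_image_le.trans ?_
        rw [Finset.card_product, Finset.card_univ]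
      have h5 := Finset.card_compl_add_card ((E ×ˢ (Finset.univ : Finset H)).image ψ)
      rw [hcov, ZMod.card] at h5
      omega
    have hq0 : (0:ℝ) < q.natAbs := by
      have : 0 < q.natAbs := by omega
      exact_mod_cast this
    have hbern : 1 - (((m' + 1) * m' * L : ℕ) : ℝ) / q.natAbs ≤ (1 - (L : ℝ) / q.natAbs) ^ ((m' + 1) * m') := by
      have hle : (L : ℝ) / q.natAbs ≤ 1 := by
        rw [div_le_one hq0]
        have : L ≤ q.natAbs := by omega
        exact_mod_cast this
      have := one_add_mul_le_pow (a := -((L : ℝ) / q.natAbs)) (by linarith) ((m' + 1) * m')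
      calc _ = 1 + (((m' + 1) * m' : ℕ) : ℝ) * (-((L : ℝ) / q.natAbs)) := by push_cast; ring
        _ ≤ _ := this
        _ = _ := by rw [sub_eq_add_neg]
    rw [Finset.card_univ, Fintype.card_prod, Fintype.card_fin, Fintype.card_fin] at hE3
    have hE4 : (n : ℝ) * (1 - (((m' + 1) * m' * L : ℕ) : ℝ) / q.natAbs) ≤ E.card * Fintype.card H := by
      rw [hcH]; push_cast at hE3 ⊢
      refine le_trans ?_ hE3
      push_cast at hbern
      gcongr
    have hR0r : (R0.ncard : ℝ) + E.card * Fintype.card H ≤ Z.card * Fintype.card H + n := by exact_mod_cast hR0c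
    have hfin : (R0.ncard : ℝ) - n * ((((m' + 1) * m' * L : ℕ) : ℝ) / q.natAbs) ≤ Z.card * Fintype.card H := by linarith
    rw [hcF]
    have := mul_le_mul_of_nonneg_left hfin (by positivity : (0:ℝ) ≤ (((m' + 1) * (m' + 1) : ℕ) : ℝ))
    calc (1 - δ - (((m' + 1) ^ 3 * m' * L : ℕ) : ℝ) / q.natAbs) * n = (1 - δ) * n - (((m' + 1) * (m' + 1) : ℕ) : ℝ) * (n * ((((m' + 1) * m' * L : ℕ) : ℝ) / q.natAbs)) := by push_cast; ring
      _ ≤ _ := sub_le_sub_right hc _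
      _ = _ := by ring
      _ ≤ _ := this
      _ = _ := by push_cast; ring

abbrev mbU (k m' : ℕ) : Type := ZMod k → Fin (m' + 1)
abbrev mbLamp (k m' L : ℕ) : Type := ZMod k → mbU k m' → ZMod L
abbrev mbY (k m' L : ℕ) : Type := mbU k m' × mbLamp k m' L

def mbShift (k m' L : ℕ) (t : ZMod k) (y : mbY k m' L) : mbY k m' L :=
  (fun i => y.1 (i - t), fun i v => y.2 (i - t) (fun l => v (l + t)))

theorem mbShift_add (k m' L : ℕ) (s t : ZMod k) (y : mbY k m' L) :
    mbShift k m' L s (mbShift k m' L t y) = mbShift k m' L (s + t) y := by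
  simp only [mbShift, sub_sub, add_assoc, add_comm t s]

theorem mbShift_zero (k m' L : ℕ) (y : mbY k m' L) : mbShift k m' L 0 y = y := by
  simp [mbShift]

/-- the rotation -/
def mbSig (k m' L : ℕ) : Equiv.Perm (mbY k m' L) where
  toFun := mbShift k m' L 1
  invFun := mbShift k m' L (-1)
  left_inv y := by rw [mbShift_add, neg_add_cancel, mbShift_zero]
  right_inv y := by rw [mbShift_add, add_neg_cancel, mbShift_zero]

theorem mbSig_pow (k m' L : ℕ) (t : ℕ) (y : mbY k m' L) :
    ((mbSig k m' L) ^ t) y = mbShift k m' L (t : ZMod k) y := by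
  induction t with
  | zero => simp [mbShift_zero]
  | succ t ih =>
    rw [pow_succ', Equiv.Perm.mul_apply, ih]
    show mbShift k m' L 1 _ = _
    rw [mbShift_add]
    push_cast
    rw [add_comm]

theorem mbSig_pow_k (k m' L : ℕ) : (mbSig k m' L) ^ k = 1 := by
  ext1 y
  rw [mbSig_pow, ZMod.natCast_self, mbShift_zero]
  rfl

/-- the elementary moves -/
noncomputable def mbMove (k m' L : ℕ) (t : ZMod k) (y : mbY k m' L) : mbY k m' L :=
  open Classical in
  (Function.update y.1 t (y.1 t + 1), fun i v => y.2 i v + if i = t ∧ v = y.1 then 1 else 0)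

theorem mbSig_move (k m' L : ℕ) (y : mbY k m' L) :
    mbSig k m' L (mbMove k m' L 0 y) = mbMove k m' L 1 (mbSig k m' L y) := by
  classical
  show mbShift k m' L 1 _ = mbMove k m' L 1 (mbShift k m' L 1 y)
  simp only [mbShift, mbMove]
  refine Prod.ext ?_ ?_
  · funext i
    simp only [Function.update_apply, sub_eq_zero, sub_self]
  · funext i v
    have : (i - 1 = 0 ∧ (fun l => v (l + 1)) = y.1) ↔ (i = 1 ∧ v = fun i => y.1 (i - 1)) := by
      rw [sub_eq_zero]
      refine and_congr_right fun _ => ⟨?_, ?_⟩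
      · intro h; rw [← h]; funext l; simp
      · intro h; rw [h]; funext l; simp
    exact congrArg (y.2 (i - 1) (fun l => v (l + 1)) + ·) (if_congr this rfl rfl)

/-- replace coordinates 0 and 1 -/
def mbAt {k m' : ℕ} (o : mbU k m') (i j : Fin (m' + 1)) : mbU k m' :=
  Function.update (Function.update o 0 i) 1 j

section
set_option linter.unusedSectionVars false
variable {k m' L : ℕ} [Fact (1 < k)]

theorem mbAt_one (o : mbU k m') (i j) : mbAt o i j 1 = j := by simp [mbAt]
theorem mbAt_zero (o : mbU k m') (i j) : mbAt o i j 0 = i := by simp [mbAt]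
theorem mbAt_at (o : mbU k m') (i j i' j') : mbAt (mbAt o i j) i' j' = mbAt o i' j' := by
  funext l
  simp only [mbAt, Function.update_apply]
  split_ifs <;> rfl
theorem mbAt_self (o : mbU k m') : mbAt o (o 0) (o 1) = o := by
  simp [mbAt]
theorem mbAt_inj (o : mbU k m') (i j i' j') : mbAt o i j = mbAt o i' j' ↔ i = i' ∧ j = j' := by
  constructor
  · intro h
    have h0 := congrFun h 0
    have h1 := congrFun h 1
    rw [mbAt_zero, mbAt_zero] at h0
    rw [mbAt_one, mbAt_one] at h1
    exact ⟨h0, h1⟩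
  · rintro ⟨rfl, rfl⟩; rfl

def mbT (o : mbU k m') (c : mbLamp k m' L) : Fin (m' + 1) → Fin m' → ZMod L := fun i j =>
  ∑ j' : Fin (m' + 1), if (j : ℕ) < j' then c 0 (mbAt o i j') else 0

def mbHx (h : Fin (m' + 1) → Fin m' → ZMod L) (i : Fin (m' + 1)) (j : ℕ) : ZMod L :=
  if hj : j < m' then h i ⟨j, hj⟩ else 0

def mbA (w : mbF m' L) (i : Fin (m' + 1)) (j : ℕ) : ZMod L :=
  (if j = 0 then (if (i : ℕ) < w.1 then 1 else 0) else mbHx w.2.2 i (j - 1)) - mbHx w.2.2 i j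

def mbB (w : mbF m' L) (i : Fin (m' + 1)) (j : ℕ) : ZMod L :=
  mbHx w.2.2 i j - mbHx w.2.2 (i - 1) j + if i = w.1 ∧ j < w.2.1 then 1 else 0

noncomputable def mbPsi (o : mbU k m') (w : mbF m' L) : mbLamp k m' L := fun t v =>
  open Classical in
  if v = mbAt o (v 0) (v 1) then
    (if t = 0 then mbA w (v 0) (v 1) else if t = 1 then mbB w (v 0) (v 1) else 0) else 0

theorem mbT_at (o : mbU k m') (c : mbLamp k m' L) (i j) : mbT (mbAt o i j) c = mbT o c := by
  funext a b; simp only [mbT, mbAt_at]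

theorem mbPsi_at (o : mbU k m') (w : mbF m' L) (i j) : mbPsi (mbAt o i j) w = mbPsi o w := by
  funext a b; simp only [mbPsi, mbAt_at]

theorem mbT_sub (o : mbU k m') (c c' : mbLamp k m' L) : mbT o (c - c') = mbT o c - mbT o c' := by
  funext i j
  simp only [mbT, Pi.sub_apply, ← Finset.sum_sub_distrib]
  refine Finset.sum_congr rfl fun x _ => ?_
  split_ifs <;> simp

theorem mbT_add (o : mbU k m') (c c' : mbLamp k m' L) : mbT o (c + c') = mbT o c + mbT o c' := by
  funext i j
  simp only [mbT, Pi.add_apply, ← Finset.sum_add_distrib]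
  refine Finset.sum_congr rfl fun x _ => ?_
  split_ifs <;> simp

theorem mbT_Psi (o : mbU k m') (w : mbF m' L) : mbT o (mbPsi o w) = w.2.2 := by
  funext i j
  have h1 : ∀ j' : Fin (m' + 1), mbPsi o w 0 (mbAt o i j') = mbA w i j' := by
    intro j'
    simp only [mbPsi, mbAt_zero, mbAt_one, if_true]
  simp only [mbT, h1]
  rw [Fin.sum_univ_eq_sum_range (fun j' => if (j : ℕ) < j' then mbA w i j' else 0) (m' + 1)]
  have h2 : ∀ N : ℕ, ∑ j' ∈ Finset.range ((j : ℕ) + 1 + N), (if (j : ℕ) < j' then mbA w i j' else 0) =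
      mbHx w.2.2 i j - mbHx w.2.2 i (j + N) := by
    intro N
    induction N with
    | zero =>
      rw [Finset.sum_eq_zero]
      · simp
      · intro x hx
        rw [Finset.mem_range] at hx
        rw [if_neg (by omega)]
    | succ N ih =>
      rw [← add_assoc, Finset.sum_range_succ, ih, if_pos (by omega), mbA, if_neg (by omega)]
      have e1 : (j : ℕ) + 1 + N - 1 = j + N := by omega
      have e2 : (j : ℕ) + 1 + N = j + (N + 1) := by omega
      rw [e1, e2]; ring
  have h3 : m' + 1 = (j : ℕ) + 1 + (m' - j) := by omega
  have hrange : Finset.range (m' + 1) = Finset.range ((j : ℕ) + 1 + (m' - j)) := congrArg _ h3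
  rw [hrange, h2]
  have h4 : (j : ℕ) + (m' - j) = m' := by omega
  rw [h4]
  simp [mbHx]

/-- the inert part -/
abbrev mbI (k m' L : ℕ) [Fact (1 < k)] : Type :=
  {x : mbY k m' L // x.1 0 = 0 ∧ x.1 1 = 0 ∧ mbT x.1 x.2 = 0}

noncomputable def mbTheta : mbY k m' L ≃ mbF m' L × mbI k m' L where
  toFun y := ((y.1 0, y.1 1, mbT y.1 y.2), ⟨(mbAt y.1 0 0, y.2 - mbPsi y.1 (y.1 0, y.1 1, mbT y.1 y.2)),
    mbAt_zero _ _ _, mbAt_one _ _ _, by simp only [mbT_at, mbT_sub, mbT_Psi, sub_self]⟩)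
  invFun x := (mbAt x.2.1.1 x.1.1 x.1.2.1, x.2.1.2 + mbPsi x.2.1.1 x.1)
  left_inv y := by
    simp only [mbAt_at, mbAt_self, mbPsi_at, sub_add_cancel]
  right_inv x := by
    obtain ⟨w, ⟨⟨o, c⟩, h0, h1, h2⟩⟩ := x
    simp only at h0 h1 h2
    have e1 : mbT (mbAt o w.1 w.2.1) (c + mbPsi o w) = w.2.2 := by
      rw [mbT_at, mbT_add, h2, mbT_Psi, zero_add]
    have e2 : mbAt o 0 0 = o := by
      conv_rhs => rw [← mbAt_self o, h0, h1]
    simp only [e1, mbAt_zero, mbAt_one, mbAt_at, mbPsi_at, e2, Prod.mk.eta, add_sub_cancel_right]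

theorem mb_update1 (u : mbU k m') (x : Fin (m' + 1)) : Function.update u 1 x = mbAt u (u 0) x := by
  simp [mbAt]

theorem mb_update0 (u : mbU k m') (x : Fin (m' + 1)) : Function.update u 0 x = mbAt u x (u 1) := by
  have h01 : (1 : ZMod k) ≠ 0 := one_ne_zero
  funext l
  simp only [mbAt, Function.update_apply]
  by_cases h1 : l = 1
  · subst h1; simp [h01]
  · simp [h1]

theorem mbPsi_diff (u : mbU k m') (w w' : mbF m' L) (b0 b1 : Prop)
    (h0 : ∀ i j : Fin (m' + 1), mbA w' i j = mbA w i j + open Classical in if b0 ∧ i = u 0 ∧ j = u 1 then 1 else 0)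
    (h1 : ∀ i j : Fin (m' + 1), mbB w' i j = mbB w i j + open Classical in if b1 ∧ i = u 0 ∧ j = u 1 then 1 else 0)
    (t : ZMod k) (v : mbU k m') :
    mbPsi u w' t v = mbPsi u w t v + open Classical in if ((t = 0 ∧ b0) ∨ (t = 1 ∧ b1)) ∧ v = u then 1 else 0 := by
  classical
  have h01 : (1 : ZMod k) ≠ 0 := one_ne_zero
  by_cases hv : v = mbAt u (v 0) (v 1)
  · have hvu : v = u ↔ (v 0 = u 0 ∧ v 1 = u 1) := by
      constructor
      · rintro rfl; exact ⟨rfl, rfl⟩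
      · rintro ⟨e0, e1⟩; rw [hv, e0, e1, mbAt_self]
    simp only [mbPsi, if_pos hv, hvu]
    by_cases ht0 : t = 0
    · subst ht0
      simp [h0, h01.symm]
    · by_cases ht1 : t = 1
      · subst ht1
        simp [h1]
      · simp [ht0, ht1]
  · have hvu : v ≠ u := by
      rintro rfl; exact hv (mbAt_self v).symm
    simp [mbPsi, hv, hvu]

theorem mbTheta_eq (y : mbY k m' L) (w : mbF m' L) (x : mbI k m' L) (h1 : y.1 0 = w.1) (h2 : y.1 1 = w.2.1)
    (h3 : mbT y.1 y.2 = w.2.2) (h4 : mbAt y.1 0 0 = x.1.1) (h5 : ∀ t v, y.2 t v = x.1.2 t v + mbPsi y.1 w t v) :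
    mbTheta y = (w, x) := by
  have hw : (y.1 0, y.1 1, mbT y.1 y.2) = w := by rw [h1, h2, h3]
  refine Prod.ext hw (Subtype.ext (Prod.ext h4 ?_))
  funext t v
  show y.2 t v - mbPsi y.1 (y.1 0, y.1 1, mbT y.1 y.2) t v = _
  rw [hw, h5]; ring

theorem mbTheta_move1 (y : mbY k m' L) (hu : (y.1 1 : ℕ) < m') :
    mbTheta (mbMove k m' L 1 y) = (((mbTheta y).1.1, (mbTheta y).1.2.1 + 1, (mbTheta y).1.2.2), (mbTheta y).2) := by
  classical
  obtain ⟨u, c⟩ := y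
  have h01 : (1 : ZMod k) ≠ 0 := one_ne_zero
  simp only at hu
  have hval : ((u 1 + 1 : Fin (m' + 1)) : ℕ) = (u 1 : ℕ) + 1 := by
    rw [Fin.val_add_one_of_lt]
    rw [Fin.lt_def]; simpa using hu
  apply mbTheta_eq
  · simp [mbMove, mbTheta, h01.symm]
  · simp [mbMove, mbTheta]
  · simp only [mbMove, mb_update1, mbT_at]
    show mbT u _ = mbT u c
    funext i j
    simp [mbT, h01.symm]
  · simp only [mbMove, mb_update1, mbAt_at]; rfl
  · intro t v
    simp only [mbMove, mb_update1, mbPsi_at]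
    show c t v + _ = (c t v - mbPsi u (u 0, u 1, mbT u c) t v) + mbPsi u (u 0, u 1 + 1, mbT u c) t v
    rw [mbPsi_diff u (u 0, u 1, mbT u c) (u 0, u 1 + 1, mbT u c) False True]
    · simp; ring_nf
    · intro i j; simp [mbA]
    · intro i j
      simp only [mbB, true_and, hval, Fin.ext_iff]
      by_cases hi : (i : ℕ) = u 0
      · rcases lt_trichotomy (j : ℕ) (u 1) with hj | hj | hj
        · simp [hi, hj, hj.ne, Nat.lt_succ_of_lt hj]
        · simp [hi, hj]
        · have h1 : ¬ ((j : ℕ) < u 1 + 1) := by omega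
          have h2 : ¬ ((j : ℕ) < u 1) := by omega
          simp only [hi, hj.ne', h1, h2, and_false, if_false, add_zero]
      · simp [hi]

theorem mbTheta_move0 (y : mbY k m' L) (hu : (y.1 0 : ℕ) < m') :
    mbTheta (mbMove k m' L 0 y) = (((mbTheta y).1.1 + 1, (mbTheta y).1.2.1,
      fun i j => (mbTheta y).1.2.2 i j + if i = (mbTheta y).1.1 ∧ (j : ℕ) < (mbTheta y).1.2.1 then 1 else 0), (mbTheta y).2) := by
  classical
  obtain ⟨u, c⟩ := y
  have h01 : (1 : ZMod k) ≠ 0 := one_ne_zero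
  simp only at hu
  have hval : ((u 0 + 1 : Fin (m' + 1)) : ℕ) = (u 0 : ℕ) + 1 := by
    rw [Fin.val_add_one_of_lt]
    rw [Fin.lt_def]; simpa using hu
  apply mbTheta_eq
  · simp [mbMove, mbTheta]
  · simp [mbMove, mbTheta]
  · simp only [mbMove, mb_update0, mbT_at]
    show mbT u _ = fun i j => mbT u c i j + if i = u 0 ∧ (j : ℕ) < u 1 then 1 else 0
    funext i j
    have hu' : ∀ i j', mbAt u i j' = u ↔ (i = u 0 ∧ j' = u 1) := by
      intro i j'
      conv_lhs => rhs; rw [← mbAt_self u]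
      exact mbAt_inj _ _ _ _ _
    simp only [mbT, true_and, hu']
    have e1 : ∀ j' : Fin (m' + 1), (if (j : ℕ) < j' then c 0 (mbAt u i j') + (if i = u 0 ∧ j' = u 1 then 1 else 0) else 0) =
        (if (j : ℕ) < j' then c 0 (mbAt u i j') else 0) + (if j' = u 1 then (if i = u 0 ∧ (j : ℕ) < u 1 then 1 else 0) else 0) := by
      intro j'
      by_cases h1 : j' = u 1
      · subst h1
        by_cases h2 : (j : ℕ) < u 1 <;> simp [h2]
      · simp [h1]
    rw [Finset.sum_congr rfl (fun j' _ => e1 j'), Finset.sum_add_distrib]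
    simp
  · simp only [mbMove, mb_update0, mbAt_at]; rfl
  · intro t v
    simp only [mbMove, mb_update0, mbPsi_at]
    set h' : Fin (m' + 1) → Fin m' → ZMod L := fun i j => mbT u c i j + if i = u 0 ∧ (j : ℕ) < u 1 then 1 else 0 with hh'
    show c t v + _ = (c t v - mbPsi u (u 0, u 1, mbT u c) t v) + mbPsi u (u 0 + 1, u 1, h') t v
    have hHx : ∀ i j, mbHx h' i j = mbHx (mbT u c) i j + if i = u 0 ∧ j < u 1 then 1 else 0 := by
      intro i j
      by_cases hj : j < m'
      · simp [mbHx, hj, hh']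
      · have : ¬ (j < (u 1 : ℕ)) := by have := (u 1).2; omega
        simp [mbHx, hj, this]
    rw [mbPsi_diff u (u 0, u 1, mbT u c) (u 0 + 1, u 1, h') True False]
    · simp; ring_nf
    · intro i j
      simp only [mbA, true_and, hval, hHx]
      simp only [Fin.ext_iff]
      by_cases hi : (i : ℕ) = u 0
      · by_cases hj0 : (j : ℕ) = 0
        · by_cases hu1 : (u 1 : ℕ) = 0
          · simp [hi, hj0, hu1]; ring
          · have h1 : 0 < (u 1 : ℕ) := by omega
            have h2 : ¬ (0 = (u 1 : ℕ)) := by omega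
            simp [hi, hj0, h1, h2]
        · rcases lt_trichotomy (j : ℕ) (u 1) with hj | hj | hj
          · have h1 : (j : ℕ) - 1 < u 1 := by omega
            simp [hi, hj0, hj, hj.ne, h1]
          · have h1 : (u 1 : ℕ) - 1 < u 1 := by omega
            have h2 : ¬ ((u 1 : ℕ) = 0) := by omega
            simp only [hi, hj, h1, h2, true_and, if_true, if_false, lt_irrefl]
            ring
          · have h1 : ¬ ((j : ℕ) - 1 < u 1) := by omega
            have h2 : ¬ ((j : ℕ) < u 1) := by omega
            simp [hi, hj0, h1, h2, hj.ne']
      · have h1 : ((i : ℕ) < u 0 + 1) ↔ (i : ℕ) < u 0 := by omega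
        simp [hi, h1]
    · intro i j
      simp only [mbB, hHx, false_and, if_false, add_zero]
      have h1 : i - 1 = u 0 ↔ i = u 0 + 1 := sub_eq_iff_eq_add
      simp only [h1]
      ring

end

theorem mb_val_succ {L : ℕ} [NeZero L] (x : ZMod L) (hx : x ≠ -1) :
    ((x + 1 : ZMod L).val : ℤ) = (x.val : ℤ) + 1 := by
  have h1 : x.val < L := ZMod.val_lt x
  have h2 : x.val + 1 ≠ L := by
    intro h
    apply hx
    have h3 : ((x.val + 1 : ℕ) : ZMod L) = 0 := by rw [h]; exact ZMod.natCast_self L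
    rw [Nat.cast_add, ZMod.natCast_zmod_val, Nat.cast_one] at h3
    exact eq_neg_of_add_eq_zero_left h3
  have h4 : x + 1 = ((x.val + 1 : ℕ) : ZMod L) := by
    rw [Nat.cast_add, ZMod.natCast_zmod_val, Nat.cast_one]
  rw [h4, ZMod.val_cast_of_lt (by omega)]
  push_cast
  rfl

theorem mb_fiber {X A : Type*} [Finite X] [Fintype A] [AddGroup A] (g : X → A) (τ : A → X → X)
    (h1 : ∀ t x, g (τ t x) = g x + t) (h2 : ∀ t x, τ (-t) (τ t x) = x) (a : A) :
    {x | g x = a}.ncard * Fintype.card A ≤ Nat.card X := by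
  let φ : {x | g x = a} × A → X := fun u => τ u.2 u.1
  have hinj : Function.Injective φ := by
    rintro ⟨⟨x, hx⟩, t⟩ ⟨⟨y, hy⟩, s⟩ h
    have hx' : g x = a := hx
    have hy' : g y = a := hy
    have h' : τ t x = τ s y := h
    have e1 := congrArg g h'
    rw [h1, h1, hx', hy'] at e1
    have e2 : t = s := add_left_cancel e1
    subst e2
    have e3 := congrArg (τ (-t)) h'
    rw [h2, h2] at e3
    subst e3
    rfl
  have := Nat.card_le_card_of_injective φ hinj
  rw [Nat.card_prod, Nat.card_coe_set_eq, Nat.card_eq_fintype_card (α := A)] at this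
  exact this

section
variable {k m' L : ℕ} [Fact (1 < k)] [NeZero L]

theorem mb_fiberY {A : Type*} [Fintype A] [AddGroup A] (g : mbF m' L → A)
    (τ : A → mbF m' L → mbF m' L)
    (h1 : ∀ t x, g (τ t x) = g x + t) (h2 : ∀ t x, τ (-t) (τ t x) = x) (a : A) :
    {y : mbY k m' L | g (mbTheta y).1 = a}.ncard * Fintype.card A ≤ Nat.card (mbY k m' L) := by
  have : NeZero k := ⟨by have := (Fact.out : 1 < k); omega⟩
  apply mb_fiber (fun y : mbY k m' L => g (mbTheta y).1)
    (fun t y => mbTheta.symm (τ t (mbTheta y).1, (mbTheta y).2))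
  · intro t x; simp [h1]
  · intro t x; simp [h2]

def mbBad0 (k m' L : ℕ) [Fact (1 < k)] : Set (mbY k m' L) :=
  {y | (mbTheta y).1.1 = Fin.last m'} ∪ ⋃ j ∈ (Finset.univ : Finset (Fin m')), {y | (mbTheta y).1.2.2 (mbTheta y).1.1 j = -1}

def mbBad1 (k m' L : ℕ) [Fact (1 < k)] : Set (mbY k m' L) :=
  {y | (mbTheta y).1.2.1 = Fin.last m'}

theorem mbBad1_card : ((mbBad1 k m' L).ncard : ℝ) ≤ Nat.card (mbY k m' L) * (1 / ((m' : ℝ) + 1)) := by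
  have h := mb_fiberY (k := k) (m' := m') (L := L) (fun w => w.2.1) (fun t w => (w.1, w.2.1 + t, w.2.2)) (fun _ _ => rfl)
    (fun t w => by simp) (Fin.last m')
  rw [Fintype.card_fin] at h
  rw [mul_one_div, le_div_iff₀ (by positivity)]
  exact_mod_cast h

theorem mbBad0_card : ((mbBad0 k m' L).ncard : ℝ) ≤ Nat.card (mbY k m' L) * (1 / ((m' : ℝ) + 1) + m' / L) := by
  have : NeZero k := ⟨by have := (Fact.out : 1 < k); omega⟩
  have hL : (0 : ℝ) < L := by exact_mod_cast Nat.pos_of_neZero L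
  have h := mb_fiberY (k := k) (m' := m') (L := L) (fun w => w.1) (fun t w => (w.1 + t, w.2)) (fun _ _ => rfl)
    (fun t w => by simp) (Fin.last m')
  rw [Fintype.card_fin] at h
  have h1 : (({y : mbY k m' L | (mbTheta y).1.1 = Fin.last m'}).ncard : ℝ) ≤ Nat.card (mbY k m' L) * (1 / ((m' : ℝ) + 1)) := by
    rw [mul_one_div, le_div_iff₀ (by positivity)]
    exact_mod_cast h
  have h2 : ∀ j : Fin m', (({y : mbY k m' L | (mbTheta y).1.2.2 (mbTheta y).1.1 j = -1}).ncard : ℝ) ≤ Nat.card (mbY k m' L) * (1 / L) := by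
    intro j
    have h := mb_fiberY (k := k) (m' := m') (L := L) (fun w => w.2.2 w.1 j) (fun t w => (w.1, w.2.1, fun a b => w.2.2 a b + t)) (fun _ _ => rfl)
      (fun t w => by simp) (-1)
    rw [ZMod.card] at h
    rw [mul_one_div, le_div_iff₀ hL]
    exact_mod_cast h
  have h3 : (mbBad0 k m' L).ncard ≤ ({y : mbY k m' L | (mbTheta y).1.1 = Fin.last m'}).ncard + ∑ j : Fin m', ({y : mbY k m' L | (mbTheta y).1.2.2 (mbTheta y).1.1 j = -1}).ncard := by
    refine (Set.ncard_union_le _ _).trans ?_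
    gcongr
    exact Finset.set_ncard_biUnion_le _ _
  have h4 : ((mbBad0 k m' L).ncard : ℝ) ≤ (({y : mbY k m' L | (mbTheta y).1.1 = Fin.last m'}).ncard : ℝ) + ∑ j : Fin m', (({y : mbY k m' L | (mbTheta y).1.2.2 (mbTheta y).1.1 j = -1}).ncard : ℝ) := by exact_mod_cast h3
  have h5 : ∑ j : Fin m', (({y : mbY k m' L | (mbTheta y).1.2.2 (mbTheta y).1.1 j = -1}).ncard : ℝ) ≤ ∑ j : Fin m', Nat.card (mbY k m' L) * (1 / (L : ℝ)) := Finset.sum_le_sum (fun j _ => h2 j)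
  rw [Finset.sum_const, Finset.card_univ, Fintype.card_fin, nsmul_eq_mul] at h5
  calc _ ≤ _ := h4
    _ ≤ _ := add_le_add h1 h5
    _ = _ := by ring

theorem mb_assemble (n : ℕ) [NeZero n] (p q : ℤ) (hpu : IsUnit (p : ZMod n)) (hqu : IsUnit (q : ZMod n))
    (hβ : 2 / ((m' : ℝ) + 1) + m' / L ≤ 1)
    (Z : Finset ℤ) (hZ : ∀ z ∈ Z, ∀ z' ∈ Z, ∀ w w' : mbF m' L,
        mbPhi n p q m' L w z = mbPhi n p q m' L w' z' → z = z' ∧ w = w') :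
    ∃ f : Equiv.Perm (ZMod n), f ^ k = 1 ∧
      (Z.card : ℝ) * Fintype.card (mbF m' L) * (1 - (2 / ((m' : ℝ) + 1) + m' / L)) - Nat.card (mbY k m' L) ≤
        (({x : ZMod n | f ((q : ZMod n) * x + 1) = (p : ZMod n) * f x}).ncard : ℝ) := by
  classical
  have hk0 : NeZero k := ⟨by have := (Fact.out : 1 < k); omega⟩
  set I := mbI k m' L with hI
  set Y := mbY k m' L with hY
  have hcY : Nat.card Y = Fintype.card (mbF m' L) * Nat.card I := by
    rw [Nat.card_congr (mbTheta (k := k) (m' := m') (L := L)), Nat.card_prod, Nat.card_eq_fintype_card]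
  have hI0 : 0 < Nat.card I := by
    have : Nonempty I := ⟨(mbTheta (fun _ => 0, fun _ _ => 0)).2⟩
    exact Nat.card_pos
  set S := Z.card / Nat.card I with hS
  have hSI : S * Nat.card I ≤ Z.card := Nat.div_mul_le_self _ _
  have hSI2 : Z.card ≤ S * Nat.card I + Nat.card I := by
    have := Nat.div_add_mod Z.card (Nat.card I)
    have h2 := Nat.mod_lt Z.card hI0
    rw [mul_comm, ← hS] at this
    omega
  have hemb : Nonempty (Fin S × I ↪ {z // z ∈ Z}) := by
    have : Fintype I := Fintype.ofFinite I
    apply Function.Embedding.nonempty_of_card_le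
    rw [Fintype.card_prod, Fintype.card_fin, Fintype.card_coe, ← Nat.card_eq_fintype_card (α := I)]
    exact hSI
  obtain ⟨ζ⟩ := hemb
  let ι : Fin S × Y ↪ ZMod n := ⟨fun u => mbPhi n p q m' L (mbTheta u.2).1 (ζ (u.1, (mbTheta u.2).2)), by
    rintro ⟨t, y⟩ ⟨t', y'⟩ h
    obtain ⟨h1, h2⟩ := hZ _ (ζ (t, (mbTheta y).2)).2 _ (ζ (t', (mbTheta y').2)).2 _ _ h
    have h3 := ζ.injective (Subtype.ext h1)
    rw [Prod.mk.injEq] at h3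
    have h4 : y = y' := mbTheta.injective (Prod.ext h2 h3.2)
    rw [h3.1, h4]⟩
  have hι : ∀ t y, ι (t, y) = mbPhi n p q m' L (mbTheta y).1 (ζ (t, (mbTheta y).2)) := fun _ _ => rfl
  let e : Equiv.Perm (Fin S × Y) := Equiv.prodCongr (Equiv.refl _) (mbSig k m' L)
  have he : ∀ t y, e (t, y) = (t, mbSig k m' L y) := fun _ _ => rfl
  have hej : ∀ (j : ℕ) t y, (e ^ j) (t, y) = (t, (mbSig k m' L ^ j) y) := by
    intro j
    induction j with
    | zero => intro t y; rfl
    | succ j ih =>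
      intro t y
      rw [pow_succ', pow_succ', Equiv.Perm.mul_apply, ih, he]
      rfl
  have hek : e ^ k = 1 := by
    refine Equiv.ext ?_
    rintro ⟨t, y⟩
    rw [hej, mbSig_pow_k]; rfl
  let f : Equiv.Perm (ZMod n) := Equiv.Perm.viaEmbeddingHom ι e
  have hf : ∀ t y, f (ι (t, y)) = ι (t, mbSig k m' L y) := by
    intro t y
    exact Equiv.Perm.viaEmbedding_apply e ι (t, y)
  refine ⟨f, ?_, ?_⟩
  · show (Equiv.Perm.viaEmbeddingHom ι e) ^ k = 1
    rw [← map_pow, hek, map_one]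
  -- good moves
  have g1 : ∀ t y, y ∉ mbBad1 k m' L → (p : ZMod n) * ι (t, y) = ι (t, mbMove k m' L 1 y) := by
    intro t y hy
    have hlt : (y.1 1 : ℕ) < m' := by
      by_contra hc
      apply hy
      show y.1 1 = Fin.last m'
      apply Fin.ext
      have := (y.1 1).2
      simp only [Fin.val_last]
      omega
    have hm := mbTheta_move1 y hlt
    rw [hι, hι, hm]
    apply mbPhi_p
    exact Fin.val_add_one_of_lt (by rw [Fin.lt_def]; exact hlt)
  have g0 : ∀ t y, y ∉ mbBad0 k m' L → (q : ZMod n) * ι (t, y) + 1 = ι (t, mbMove k m' L 0 y) := by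
    intro t y hy
    have hlt : (y.1 0 : ℕ) < m' := by
      by_contra hc
      apply hy
      left
      show y.1 0 = Fin.last m'
      apply Fin.ext
      have := (y.1 0).2
      simp only [Fin.val_last]
      omega
    have hm := mbTheta_move0 y hlt
    rw [hι, hι, hm]
    apply mbPhi_q n p q hpu hqu
    · exact Fin.val_add_one_of_lt (by rw [Fin.lt_def]; exact hlt)
    · intro i j
      by_cases hij : i = (mbTheta y).1.1 ∧ (j : ℕ) < (mbTheta y).1.2.1
      · have hij2 : i = y.1 0 ∧ (j : ℕ) < y.1 1 := hij
        rw [if_pos hij, if_pos hij2]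
        have hne : (mbTheta y).1.2.2 i j ≠ -1 := by
          intro hc
          apply hy
          right
          simp only [Set.mem_iUnion]
          refine ⟨j, Finset.mem_univ _, ?_⟩
          show (mbTheta y).1.2.2 (mbTheta y).1.1 j = -1
          rw [← hij.1]; exact hc
        exact mb_val_succ _ hne
      · have hij2 : ¬ (i = y.1 0 ∧ (j : ℕ) < y.1 1) := hij
        rw [if_neg hij, if_neg hij2, add_zero, add_zero]
        rfl
  let Gd : Set Y := {y | y ∉ mbBad0 k m' L ∧ mbSig k m' L y ∉ mbBad1 k m' L}
  have hsub : ι '' (Set.univ ×ˢ Gd) ⊆ {x : ZMod n | f ((q : ZMod n) * x + 1) = (p : ZMod n) * f x} := by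
    rintro _ ⟨⟨t, y⟩, ⟨-, hy0, hy1⟩, rfl⟩
    show f ((q : ZMod n) * ι (t, y) + 1) = (p : ZMod n) * f (ι (t, y))
    rw [g0 t y hy0, hf, hf, g1 t _ hy1, mbSig_move]
  have hcount : S * Gd.ncard ≤ {x : ZMod n | f ((q : ZMod n) * x + 1) = (p : ZMod n) * f x}.ncard := by
    refine le_trans (le_of_eq ?_) (Set.ncard_le_ncard hsub (Set.toFinite _))
    rw [Set.ncard_image_of_injective _ ι.injective, Set.ncard_prod, Set.ncard_univ, Nat.card_fin]
  have hGd : Nat.card Y ≤ Gd.ncard + (mbBad0 k m' L).ncard + (mbBad1 k m' L).ncard := by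
    have h1 : (Set.univ : Set Y) ⊆ (Gd ∪ mbBad0 k m' L) ∪ {y | mbSig k m' L y ∈ mbBad1 k m' L} := by
      intro y _
      by_cases h0 : y ∈ mbBad0 k m' L
      · left; right; exact h0
      · by_cases h1 : mbSig k m' L y ∈ mbBad1 k m' L
        · right; exact h1
        · left; left; exact ⟨h0, h1⟩
    have h2 := Set.ncard_le_ncard h1 (Set.toFinite _)
    rw [Set.ncard_univ] at h2
    have h3 := Set.ncard_union_le (Gd ∪ mbBad0 k m' L) {y | mbSig k m' L y ∈ mbBad1 k m' L}
    have h4 := Set.ncard_union_le Gd (mbBad0 k m' L)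
    rw [mb_ncard_pre] at h3
    omega
  have r1 : (S : ℝ) * Gd.ncard ≤ (({x : ZMod n | f ((q : ZMod n) * x + 1) = (p : ZMod n) * f x}).ncard : ℝ) := by exact_mod_cast hcount
  have r2 : (Nat.card Y : ℝ) ≤ Gd.ncard + (mbBad0 k m' L).ncard + (mbBad1 k m' L).ncard := by exact_mod_cast hGd
  have r3 := mbBad0_card (k := k) (m' := m') (L := L)
  have r4 := mbBad1_card (k := k) (m' := m') (L := L)
  set β : ℝ := 2 / ((m' : ℝ) + 1) + m' / L with hβd
  have hβ0 : 0 ≤ β := by positivity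
  have r5 : (Nat.card Y : ℝ) * (1 - β) ≤ Gd.ncard := by
    have : (Nat.card Y : ℝ) * (1 - β) = Nat.card Y - Nat.card Y * (1 / ((m' : ℝ) + 1) + m' / L) - Nat.card Y * (1 / ((m' : ℝ) + 1)) := by
      rw [hβd]; ring
    linarith
  have r6 : (Z.card : ℝ) * Fintype.card (mbF m' L) ≤ S * Nat.card Y + Nat.card Y := by
    have : Z.card * Fintype.card (mbF m' L) ≤ S * Nat.card Y + Nat.card Y := by
      rw [hcY]
      calc _ ≤ (S * Nat.card I + Nat.card I) * Fintype.card (mbF m' L) := Nat.mul_le_mul_right _ hSI2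
        _ = _ := by ring
    exact_mod_cast this
  have hYr : (0:ℝ) ≤ Nat.card Y := by positivity
  have r7 : (S : ℝ) * (Nat.card Y * (1 - β)) ≤ S * Gd.ncard := mul_le_mul_of_nonneg_left r5 (by positivity)
  have r8 := mul_le_mul_of_nonneg_right r6 (by linarith : 0 ≤ 1 - β)
  nlinarith
end

/-- **Theorem (free metabelian version).** For every `ε > 0` and `k ≥ 2` there is `C` such
that for all integers `p, q` and positive `n` with `n` coprime to `p` and `q`, `|q| > C`,
`|p| > |q|^C` and `n > |p|^C`, there is a permutation `f` of `ℤ/nℤ` of order dividing `k`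
with `f(q·x+1) = p·f(x)` for at least `(1-ε)n` elements `x ∈ ℤ/nℤ`. -/
theorem exists_perm_metabelian (ε : ℝ) (hε : 0 < ε) (k : ℕ) (hk : 2 ≤ k) :
    ∃ C : ℕ, ∀ (p q : ℤ) (n : ℕ), 0 < n → Int.gcd p n = 1 → Int.gcd q n = 1 →
      (C : ℤ) < |q| → |q| ^ C < |p| → |p| ^ C < (n : ℤ) →
      ∃ f : Equiv.Perm (ZMod n), f ^ k = 1 ∧
        (1 - ε) * n ≤
          (({x : ZMod n | f ((q : ZMod n) * x + 1) = (p : ZMod n) * f x}).ncard : ℝ) := by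
  have hkF : Fact (1 < k) := ⟨hk⟩
  obtain ⟨η, hη0, hη1, hηε⟩ : ∃ η : ℝ, 0 < η ∧ η ≤ 1 ∧ η ≤ ε :=
    ⟨min ε 1, lt_min hε one_pos, min_le_right _ _, min_le_left _ _⟩
  obtain ⟨m', hm'⟩ := exists_nat_gt (16 / η)
  have hm1 : 2 / ((m' : ℝ) + 1) ≤ η / 8 := by
    rw [div_lt_iff₀ hη0] at hm'
    rw [div_le_iff₀ (by positivity)]
    nlinarith
  obtain ⟨L, hL⟩ := exists_nat_gt (8 * m' / η)
  have hLpos : (0 : ℝ) < L := lt_of_le_of_lt (by positivity) hL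
  have hL0 : NeZero L := ⟨by rintro rfl; simp at hLpos⟩
  have hL1 : (m' : ℝ) / L ≤ η / 8 := by
    rw [div_lt_iff₀ hη0] at hL
    rw [div_le_iff₀ hLpos]
    nlinarith
  obtain ⟨C1, hC1⟩ := mb_rokhlin (m' + 1) (2 * m' + 3) (Nat.succ_pos _) (η / 4) (by positivity)
  obtain ⟨C2, hC2⟩ := exists_nat_gt (4 * (((m' + 1) ^ 3 * m' * L : ℕ) : ℝ) / η)
  obtain ⟨C3, hC3⟩ := exists_nat_gt (4 * (Nat.card (mbY k m' L) : ℝ) / η)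
  refine ⟨C1 + (2 * m' + 3) + L + ((m' + 1) * m' * L + (m' + 1)) + C2 + C3 + 2, ?_⟩
  set C := C1 + (2 * m' + 3) + L + ((m' + 1) * m' * L + (m' + 1)) + C2 + C3 + 2 with hC
  intro p q n hn hpn hqn hq hp hnp
  have hn0 : NeZero n := ⟨hn.ne'⟩
  have hCC : (C : ℤ) = C1 + (2 * m' + 3) + L + (((m' + 1) * m' * L + (m' + 1) : ℕ) : ℤ) + C2 + C3 + 2 := by
    rw [hC]; push_cast; ring
  have hr0 : (0 : ℤ) ≤ (((m' + 1) * m' * L + (m' + 1) : ℕ) : ℤ) := Int.natCast_nonneg _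
  have hq1 : 1 ≤ |q| := by omega
  have hqp : |q| < |p| := lt_of_le_of_lt (le_self_pow₀ hq1 (by omega)) hp
  have hp1 : 1 ≤ |p| := by omega
  have hpn' : |p| < n := lt_of_le_of_lt (le_self_pow₀ hp1 (by omega)) hnp
  have hpq (a : ℕ) (ha : a ≤ C) : |q| ^ a < |p| := lt_of_le_of_lt (pow_le_pow_right₀ hq1 ha) hp
  have hnp' (a : ℕ) (ha : a ≤ C) : |p| ^ a < n := lt_of_le_of_lt (pow_le_pow_right₀ hp1 ha) hnp
  obtain ⟨R, R0, hR, hR0, hc⟩ := hC1 p q n hn hpn hqn (by omega) (hpq _ (by omega)) (hnp' _ (by omega))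
  have hpu := mb_isUnit p n hpn
  have hqu := mb_isUnit q n hqn
  obtain ⟨Z, hZ, hZc⟩ := mb_Z n p q hpu hqu m' L (by omega) (by omega) (hpq (m' + 1) (by omega)).le
    (by omega) (hnp' (2 * m' + 3) (by omega)).le (η / 4) R R0 hR hR0 hc
  have hβ : 2 / ((m' : ℝ) + 1) + m' / L ≤ η / 4 := by linarith
  obtain ⟨f, hf, hfc⟩ := mb_assemble (k := k) (m' := m') (L := L) n p q hpu hqu (by linarith) Z hZ
  refine ⟨f, hf, ?_⟩
  refine le_trans ?_ hfc
  have hqa : (C2 : ℝ) ≤ (q.natAbs : ℝ) := by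
    have hab := Int.abs_eq_natAbs q
    have : C2 ≤ q.natAbs := by omega
    exact_mod_cast this
  have hna : (C3 : ℝ) ≤ (n : ℝ) := by
    have : C3 ≤ n := by omega
    exact_mod_cast this
  have hC2' : 0 < (C2 : ℝ) := lt_of_le_of_lt (by positivity) hC2
  have hN : (0 : ℝ) < n := by exact_mod_cast hn
  have e1 : (((m' + 1) ^ 3 * m' * L : ℕ) : ℝ) / q.natAbs ≤ η / 4 := by
    rw [div_lt_iff₀ hη0] at hC2
    rw [div_le_iff₀ (by linarith)]
    nlinarith
  have e2 : (Nat.card (mbY k m' L) : ℝ) ≤ η / 4 * n := by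
    rw [div_lt_iff₀ hη0] at hC3
    nlinarith
  set W : ℝ := (Z.card : ℝ) * Fintype.card (mbF m' L)
  set β : ℝ := 2 / ((m' : ℝ) + 1) + m' / L
  have e3 : (1 - η / 2) * n ≤ W := by
    refine le_trans ?_ hZc
    apply mul_le_mul_of_nonneg_right _ hN.le
    linarith
  have e4 : (1 - η / 2) * n * (1 - η / 4) ≤ W * (1 - β) :=
    mul_le_mul e3 (by linarith) (by linarith) (le_trans (mul_nonneg (by linarith) hN.le) e3)
  have e5 : (1 - ε) * n ≤ (1 - η) * n := mul_le_mul_of_nonneg_right (by linarith) hN.le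
  have e6 : 0 ≤ η * η * n := by positivity
  nlinarith
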